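/- Let {R_i}_{i∈I} be a collection of biclosed subsets of Φ⁺ such that ⋂_{i∈I} R_i contains a simple root (an element of Δ). Then the smallest closed subset of Φ⁺ containing ⋃_{i∈I} R_i equals Φ⁺ ∩ Span_{≥0}(⋃_{i∈I} R_i). -/

import Mathlib

open scoped NNReal

noncomputable section

/-- The ambient vector space `V = ℝ³`. -/
abbrev V : Type := Fin 3 → ℝ

/-- The symmetric bilinear form with `⟨αᵢ,αⱼ⟩ = 1` if `i = j` and `-1` otherwise. -/
def B (x y : V) : ℝ := 2 * (∑ i, x i * y i) - (∑ i, x i) * (∑ i, y i)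

/-- The associated quadratic form. -/
def Q (x : V) : ℝ := B x x

/-- The simple roots `α₁, α₂, α₃` (the standard basis vectors). -/
def α (i : Fin 3) : V := Pi.single i 1

/-- The set of simple roots. -/
def Δ : Set V := Set.range α

/-- `f` is the reflection `r_{αᵢ} : x ↦ x - 2⟨αᵢ,x⟩αᵢ` for some `i` (note `⟨αᵢ,αᵢ⟩ = 1`). -/
def IsSimpleReflection (f : V ≃ₗ[ℝ] V) : Prop :=
  ∃ i : Fin 3, ∀ x : V, f x = x - (2 * B (α i) x) • α i

/-- The group `W ≤ GL(V)` generated by the three simple reflections: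
the standard reflection representation of `U₃`. -/
def W : Subgroup (V ≃ₗ[ℝ] V) := Subgroup.closure {f | IsSimpleReflection f}

/-- The root system `Φ = {w·αᵢ : w ∈ W, i ∈ {1,2,3}}`. -/
def Φ : Set V := {x | ∃ w ∈ W, ∃ i : Fin 3, x = w (α i)}

/-- `Span_{≥0}(X)`: the set of nonnegative linear combinations of elements of `X`. -/
def nnspan (X : Set V) : Set V := (Submodule.span ℝ≥0 X : Set V)

/-- The positive roots `Φ⁺ = Φ ∩ Span_{≥0}(Δ)`. -/
def Φpos : Set V := Φ ∩ nnspan Δ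

/-- `R ⊆ Φ⁺` is closed if for all `a, b ∈ R`, `Span_{≥0}{a,b} ∩ Φ⁺ ⊆ R`. -/
def IsClosedSet (R : Set V) : Prop := ∀ a ∈ R, ∀ b ∈ R, nnspan {a, b} ∩ Φpos ⊆ R

/-- `R` is a biclosed subset of `Φ⁺`. -/
def IsBiclosed (R : Set V) : Prop := R ⊆ Φpos ∧ IsClosedSet R ∧ IsClosedSet (Φpos \ R)

/-! ### The bilinear form -/

lemma B_eq (x y : V) : B x y = 2 * (x 0 * y 0 + x 1 * y 1 + x 2 * y 2)
    - (x 0 + x 1 + x 2) * (y 0 + y 1 + y 2) := by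
  simp [B, Fin.sum_univ_three]

lemma B_comm (x y : V) : B x y = B y x := by
  rw [B_eq, B_eq]; ring

lemma B_add_left (x y z : V) : B (x + y) z = B x z + B y z := by
  simp only [B_eq, Pi.add_apply]; ring

lemma B_sub_left (x y z : V) : B (x - y) z = B x z - B y z := by
  simp only [B_eq, Pi.sub_apply]; ring

lemma B_neg_left (x z : V) : B (-x) z = -B x z := by
  simp only [B_eq, Pi.neg_apply]; ring

lemma B_smul_left (r : ℝ) (x z : V) : B (r • x) z = r * B x z := by
  simp only [B_eq, Pi.smul_apply, smul_eq_mul]; ring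

lemma B_add_right (x y z : V) : B z (x + y) = B z x + B z y := by
  simp only [B_eq, Pi.add_apply]; ring

lemma B_sub_right (x y z : V) : B z (x - y) = B z x - B z y := by
  simp only [B_eq, Pi.sub_apply]; ring

lemma B_neg_right (x z : V) : B z (-x) = -B z x := by
  simp only [B_eq, Pi.neg_apply]; ring

lemma B_smul_right (r : ℝ) (x z : V) : B z (r • x) = r * B z x := by
  simp only [B_eq, Pi.smul_apply, smul_eq_mul]; ring

lemma B_zero_right (z : V) : B z 0 = 0 := by
  simp [B_eq]

/-- The height of a vector: the sum of its coordinates in the basis `Δ`. -/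
def ht (x : V) : ℝ := x 0 + x 1 + x 2

lemma ht_add (x y : V) : ht (x + y) = ht x + ht y := by
  simp only [ht, Pi.add_apply]; ring

lemma ht_sub (x y : V) : ht (x - y) = ht x - ht y := by
  simp only [ht, Pi.sub_apply]; ring

lemma ht_smul (r : ℝ) (x : V) : ht (r • x) = r * ht x := by
  simp only [ht, Pi.smul_apply, smul_eq_mul]; ring

/-- The reflection in a vector `v` with `B v v = 1`. -/
def rootRefl (v x : V) : V := x - (2 * B v x) • v

lemma rootRefl_rootRefl {v : V} (hv : B v v = 1) (x : V) : rootRefl v (rootRefl v x) = x := by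
  simp only [rootRefl, B_sub_right, B_smul_right, hv]
  module

lemma B_rootRefl {v : V} (hv : B v v = 1) (x y : V) : B (rootRefl v x) (rootRefl v y) = B x y := by
  simp only [rootRefl, B_sub_right, B_smul_right, B_sub_left, B_smul_left, hv, B_comm v x]
  ring

lemma B_α (i : Fin 3) (x : V) : B (α i) x = 2 * x i - ht x := by
  fin_cases i <;> simp [B_eq, α, ht]

lemma α_apply (i j : Fin 3) : α i j = if j = i then 1 else 0 := by
  simp [α, Pi.single_apply]

lemma B_α' (x : V) (i : Fin 3) : B (α i) x = x i - x (i + 1) - x (i + 2) := by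
  fin_cases i <;> simp [B_eq, α] <;> ring

lemma B_α_self (i : Fin 3) : B (α i) (α i) = 1 := by
  rw [B_α']; fin_cases i <;> simp [α_apply]

/-! ### Roots as integral vectors of norm one -/

/-- Vectors with integer coordinates. -/
def IntVec (x : V) : Prop := ∃ z : Fin 3 → ℤ, ∀ i, x i = z i

lemma IntVec.neg {x : V} (hx : IntVec x) : IntVec (-x) := by
  obtain ⟨z, hz⟩ := hx
  exact ⟨-z, fun i => by simp [hz]⟩

lemma IntVec.B {x y : V} (hx : IntVec x) (hy : IntVec y) :
    ∃ n : ℤ, B x y = n := by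
  obtain ⟨z, hz⟩ := hx
  obtain ⟨w, hw⟩ := hy
  refine ⟨2 * (z 0 * w 0 + z 1 * w 1 + z 2 * w 2)
    - (z 0 + z 1 + z 2) * (w 0 + w 1 + w 2), ?_⟩
  rw [B_eq]; simp only [hz, hw]; push_cast; ring

lemma IntVec.rootRefl {v x : V} (hv : IntVec v) (hx : IntVec x) :
    IntVec (rootRefl v x) := by
  obtain ⟨n, hn⟩ := hv.B hx
  obtain ⟨z, hz⟩ := hx
  obtain ⟨w, hw⟩ := hv
  exact ⟨fun i => z i - 2 * n * w i, fun i => by simp [_root_.rootRefl, hz, hw, hn]⟩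

lemma intVec_α (i : Fin 3) : IntVec (α i) :=
  ⟨fun j => if j = i then 1 else 0, fun j => by rw [α_apply]; push_cast; rfl⟩

/-- The simple reflection `r_{αᵢ}` as a linear automorphism. -/
def simpleRefl (i : Fin 3) : V ≃ₗ[ℝ] V :=
  LinearEquiv.ofInvolutive
    { toFun := rootRefl (α i)
      map_add' := fun x y => by simp only [rootRefl, B_add_right]; module
      map_smul' := fun r x => by
        simp only [rootRefl, B_smul_right, RingHom.id_apply]; module }
    (fun x => rootRefl_rootRefl (B_α_self i) x)

lemma simpleRefl_apply (i : Fin 3) (x : V) : simpleRefl i x = rootRefl (α i) x := rfl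

lemma simpleRefl_mem (i : Fin 3) : simpleRefl i ∈ W :=
  Subgroup.subset_closure ⟨i, fun _ => rfl⟩

lemma rootRefl_mem_Φ_of_simple (i : Fin 3) {x : V} (hx : x ∈ Φ) : rootRefl (α i) x ∈ Φ := by
  obtain ⟨w, hw, j, rfl⟩ := hx
  exact ⟨simpleRefl i * w, W.mul_mem (simpleRefl_mem i) hw, j, rfl⟩

lemma α_mem_Φ (i : Fin 3) : α i ∈ Φ := ⟨1, W.one_mem, i, rfl⟩

lemma neg_mem_Φ {x : V} (hx : x ∈ Φ) : -x ∈ Φ := by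
  obtain ⟨w, hw, j, rfl⟩ := hx
  refine ⟨w * simpleRefl j, W.mul_mem hw (simpleRefl_mem j), j, ?_⟩
  have : rootRefl (α j) (α j) = -α j := by simp only [rootRefl, B_α_self]; module
  simp [LinearEquiv.mul_apply, simpleRefl_apply, this]

lemma W_invariant {w : V ≃ₗ[ℝ] V} (hw : w ∈ W) :
    ∀ x, (IntVec x ↔ IntVec (w x)) ∧ B (w x) (w x) = B x x := by
  induction hw using Subgroup.closure_induction with
  | mem f hf =>
    obtain ⟨i, hi⟩ := hf
    intro x
    have hfx : f x = rootRefl (α i) x := hi x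
    rw [hfx]
    refine ⟨⟨fun h => (intVec_α i).rootRefl h, fun h => ?_⟩, B_rootRefl (B_α_self i) x x⟩
    rw [← rootRefl_rootRefl (B_α_self i) x]
    exact (intVec_α i).rootRefl h
  | one => intro x; simp
  | mul f g _ _ hf hg =>
    intro x
    exact ⟨(hg x).1.trans (hf (g x)).1, (hf (g x)).2.trans (hg x).2⟩
  | inv f _ hf =>
    intro x
    have := hf (f⁻¹ x)
    rw [show f (f⁻¹ x) = x from f.apply_symm_apply x] at this
    exact ⟨this.1.symm, this.2.symm⟩

lemma integral_of_mem_Φ {x : V} (hx : x ∈ Φ) : IntVec x ∧ B x x = 1 := by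
  obtain ⟨w, hw, i, rfl⟩ := hx
  exact ⟨(W_invariant hw _).1.1 (intVec_α i), (W_invariant hw _).2.trans (B_α_self i)⟩

/-- Vectors in the nonnegative octant. -/
def Oct (x : V) : Prop := ∀ i, 0 ≤ x i

lemma int_sign {x y z : ℤ} (h : (x - y - z) ^ 2 - 4 * y * z = 1) (hx : x < 0) :
    (y ≤ 0 ∧ z ≤ 0) := by
  by_contra hcon
  rw [not_and_or] at hcon
  rcases hcon with hy | hz
  · push Not at hy
    by_cases hz : 0 ≤ z
    · nlinarith [sq_nonneg (y - z), mul_nonneg hy.le hz]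
    · nlinarith [sq_nonneg (x - z), mul_pos hy (neg_pos.2 hx), mul_pos hy (neg_pos.2 (not_le.1 hz))]
  · push Not at hz
    by_cases hy : 0 ≤ y
    · nlinarith [sq_nonneg (y - z), mul_nonneg hy hz.le]
    · nlinarith [sq_nonneg (x - y), mul_pos hz (neg_pos.2 hx), mul_pos hz (neg_pos.2 (not_le.1 hy))]

lemma int_zero_of_sign {x y z : ℤ} (h : (x - y - z) ^ 2 - 4 * y * z = 1) (hx : x < 0)
    (hy : 0 ≤ y) (hz : 0 ≤ z) : x = -1 ∧ y = 0 ∧ z = 0 := by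
  obtain ⟨h1, h2⟩ := int_sign h hx
  obtain rfl : y = 0 := le_antisymm h1 hy
  obtain rfl : z = 0 := le_antisymm h2 hz
  refine ⟨by nlinarith, rfl, rfl⟩

lemma B_self_eq (x : V) (i : Fin 3) :
    B x x = (x i - x (i + 1) - x (i + 2)) ^ 2 - 4 * x (i + 1) * x (i + 2) := by
  fin_cases i <;> simp [B_eq] <;> ring

lemma eq_α_iff (x : V) (i : Fin 3) : x = α i ↔ x i = 1 ∧ x (i + 1) = 0 ∧ x (i + 2) = 0 := by
  rw [funext_iff, Fin.forall_fin_succ, Fin.forall_fin_succ, Fin.forall_fin_succ]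
  fin_cases i <;> simp [α_apply] <;> tauto

lemma forall_fin_three (i : Fin 3) (p : Fin 3 → Prop) :
    (∀ j, p j) ↔ p i ∧ p (i + 1) ∧ p (i + 2) := by
  rw [Fin.forall_fin_succ, Fin.forall_fin_succ, Fin.forall_fin_succ]
  fin_cases i <;> simp <;> tauto

lemma rootRefl_α_apply (x : V) (i : Fin 3) :
    rootRefl (α i) x i = 2 * (x (i + 1) + x (i + 2)) - x i ∧
    rootRefl (α i) x (i + 1) = x (i + 1) ∧ rootRefl (α i) x (i + 2) = x (i + 2) := by
  simp only [rootRefl, Pi.sub_apply, Pi.smul_apply, smul_eq_mul, B_α', α_apply]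
  fin_cases i <;> simp <;> ring

lemma exists_B_α_pos {x : V} (ho : Oct x) (hq : 0 < B x x) : ∃ i, 0 < B (α i) x := by
  by_contra! hcon
  have : B x x = x 0 * B (α 0) x + x 1 * B (α 1) x + x 2 * B (α 2) x := by
    simp only [B_α, ht, B_eq x x]; ring
  nlinarith [mul_nonneg (ho 0) (neg_nonneg.2 (hcon 0)), mul_nonneg (ho 1) (neg_nonneg.2 (hcon 1)),
    mul_nonneg (ho 2) (neg_nonneg.2 (hcon 2))]

/-- A simple reflection permutes the positive integral vectors of norm one, apart from its
own simple root. -/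
lemma oct_rootRefl_α {x : V} (hi : IntVec x) (hq : B x x = 1) (ho : Oct x) (i : Fin 3)
    (hne : x ≠ α i) : Oct (rootRefl (α i) x) := by
  obtain ⟨h0, h1, h2⟩ := rootRefl_α_apply x i
  by_contra hcon
  have hlt : rootRefl (α i) x i < 0 := by
    by_contra hge
    exact hcon ((forall_fin_three i _).2 ⟨not_lt.1 hge, h1 ▸ ho _, h2 ▸ ho _⟩)
  obtain ⟨z, hz⟩ := (intVec_α i).rootRefl hi
  have hQ : B (rootRefl (α i) x) (rootRefl (α i) x) = 1 := (B_rootRefl (B_α_self i) x x).trans hq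
  rw [B_self_eq _ i] at hQ
  have e1 := ho (i + 1)
  have e2 := ho (i + 2)
  rw [← h1, hz] at e1
  rw [← h2, hz] at e2
  rw [hz] at hlt
  simp only [hz] at hQ
  norm_cast at hQ e1 e2 hlt
  obtain ⟨a, b, c⟩ := int_zero_of_sign hQ hlt e1 e2
  rw [hz, a] at h0
  rw [hz, b] at h1
  rw [hz, c] at h2
  refine hne ((eq_α_iff _ i).2 ⟨?_, by simpa using h1.symm, by simpa using h2.symm⟩)
  rw [← h1, ← h2] at h0
  push_cast at h0
  linarith

lemma ht_rootRefl_α (x : V) (i : Fin 3) : ht (rootRefl (α i) x) = ht x - 2 * B (α i) x := by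
  rw [rootRefl, ht_sub, ht_smul]
  have : ht (α i) = 1 := by fin_cases i <;> simp [ht, α]
  rw [this, mul_one]

lemma IntVec.ht {x : V} (hx : IntVec x) : ∃ n : ℤ, ht x = n := by
  obtain ⟨z, hz⟩ := hx
  exact ⟨z 0 + z 1 + z 2, by simp [_root_.ht, hz]⟩

lemma ht_nonneg {x : V} (ho : Oct x) : 0 ≤ ht x := by
  have := ho 0; have := ho 1; have := ho 2
  simp only [ht]; linarith

/-- Strong induction on the height of an integral vector in the octant. -/
lemma ht_induction {p : V → Prop}
    (h : ∀ x, IntVec x → Oct x → (∀ y, IntVec y → Oct y → ht y < ht x → p y) → p x)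
    {x : V} (hi : IntVec x) (ho : Oct x) : p x := by
  obtain ⟨n, hn⟩ := hi.ht
  obtain ⟨m, rfl⟩ := Int.eq_ofNat_of_zero_le (by exact_mod_cast hn ▸ ht_nonneg ho : 0 ≤ n)
  induction m using Nat.strong_induction_on generalizing x with
  | _ m ih =>
    refine h x hi ho fun y hyi hyo hlt => ?_
    obtain ⟨k, hk⟩ := hyi.ht
    obtain ⟨l, rfl⟩ := Int.eq_ofNat_of_zero_le (by exact_mod_cast hk ▸ ht_nonneg hyo : 0 ≤ k)
    exact ih l (by rw [hk, hn] at hlt; exact_mod_cast hlt) hyi hyo hk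

lemma mem_Φ_of_oct {x : V} (hi : IntVec x) (hq : B x x = 1) (ho : Oct x) : x ∈ Φ := by
  revert hq
  refine ht_induction (p := fun x => B x x = 1 → x ∈ Φ) (fun x hi ho ih hq => ?_) hi ho
  obtain ⟨i, hpos⟩ := exists_B_α_pos ho (hq ▸ one_pos)
  by_cases hne : x = α i
  · exact hne ▸ α_mem_Φ i
  · have := ih (rootRefl (α i) x) ((intVec_α i).rootRefl hi) (oct_rootRefl_α hi hq ho i hne)
      (by rw [ht_rootRefl_α]; linarith) ((B_rootRefl (B_α_self i) x x).trans hq)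
    rw [← rootRefl_rootRefl (B_α_self i) x]
    exact rootRefl_mem_Φ_of_simple i this

lemma oct_or_neg_oct {x : V} (hi : IntVec x) (hq : B x x = 1) : Oct x ∨ Oct (-x) := by
  by_contra hcon
  rw [not_or] at hcon
  obtain ⟨h1, h2⟩ := hcon
  simp only [Oct, not_forall, not_le] at h1
  obtain ⟨i, h1⟩ := h1
  refine h2 ((forall_fin_three i _).2 ?_)
  rw [B_self_eq _ i] at hq
  obtain ⟨z, hz⟩ := hi
  simp only [hz] at hq h1
  norm_cast at hq h1
  obtain ⟨a, b⟩ := int_sign hq h1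
  simp only [Pi.neg_apply, hz]
  exact ⟨by exact_mod_cast (neg_pos.2 h1).le, by exact_mod_cast neg_nonneg.2 a,
    by exact_mod_cast neg_nonneg.2 b⟩

lemma mem_Φ_iff {x : V} : x ∈ Φ ↔ IntVec x ∧ B x x = 1 := by
  refine ⟨integral_of_mem_Φ, fun ⟨hi, hq⟩ => ?_⟩
  rcases oct_or_neg_oct hi hq with h | h
  · exact mem_Φ_of_oct hi hq h
  · rw [← neg_neg x]
    exact neg_mem_Φ (mem_Φ_of_oct hi.neg (by rw [B_neg_left, B_neg_right, neg_neg, hq]) h)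

lemma mem_nnspan_Δ_iff {x : V} : x ∈ nnspan Δ ↔ Oct x := by
  constructor
  · intro h
    induction h using Submodule.span_induction with
    | mem x hx =>
      obtain ⟨i, rfl⟩ := hx
      intro j; rw [α_apply]; split_ifs <;> simp
    | zero => intro j; simp
    | add x y _ _ hx hy => intro j; exact add_nonneg (hx j) (hy j)
    | smul r x _ hx => intro j; exact mul_nonneg r.2 (hx j)
  · intro h
    have : x = ∑ i, (⟨x i, h i⟩ : ℝ≥0) • α i := by
      funext j
      simp only [Fin.sum_univ_three, Pi.add_apply]
      fin_cases j <;> simp [α]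
    rw [this]
    exact Submodule.sum_mem _ fun i _ => Submodule.smul_mem _ _ (Submodule.subset_span ⟨i, rfl⟩)

lemma mem_Φpos_iff {x : V} : x ∈ Φpos ↔ IntVec x ∧ B x x = 1 ∧ Oct x := by
  rw [Φpos, Set.mem_inter_iff, mem_Φ_iff, mem_nnspan_Δ_iff, and_assoc]

lemma mem_nnspan_pair {a b x : V} :
    x ∈ nnspan {a, b} ↔ ∃ s t : ℝ, 0 ≤ s ∧ 0 ≤ t ∧ x = s • a + t • b := by
  rw [nnspan, SetLike.mem_coe, Submodule.mem_span_pair]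
  constructor
  · rintro ⟨s, t, rfl⟩
    exact ⟨s, t, s.2, t.2, rfl⟩
  · rintro ⟨s, t, hs, ht, rfl⟩
    exact ⟨⟨s, hs⟩, ⟨t, ht⟩, rfl⟩

lemma mem_Φ_or {x : V} (hx : x ∈ Φ) : x ∈ Φpos ∨ -x ∈ Φpos := by
  obtain ⟨hi, hq⟩ := mem_Φ_iff.1 hx
  rcases oct_or_neg_oct hi hq with h | h
  · exact Or.inl (mem_Φpos_iff.2 ⟨hi, hq, h⟩)
  · exact Or.inr (mem_Φpos_iff.2 ⟨hi.neg, by rw [B_neg_left, B_neg_right, neg_neg, hq], h⟩)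

lemma rootRefl_mem_Φ {v x : V} (hv : v ∈ Φ) (hx : x ∈ Φ) : rootRefl v x ∈ Φ := by
  rw [mem_Φ_iff] at *
  exact ⟨hv.1.rootRefl hx.1, (B_rootRefl hv.2 x x).trans hx.2⟩

/-- The form takes odd integer values on pairs of roots. -/
lemma B_odd {x y : V} (hx : x ∈ Φ) (hy : y ∈ Φ) : ∃ n : ℤ, B x y = 2 * n + 1 := by
  obtain ⟨⟨z, hz⟩, hq⟩ := mem_Φ_iff.1 hx
  obtain ⟨⟨w, hw⟩, hq'⟩ := mem_Φ_iff.1 hy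
  have odd : ∀ u : Fin 3 → ℤ, (2 * (u 0 * u 0 + u 1 * u 1 + u 2 * u 2)
      - (u 0 + u 1 + u 2) * (u 0 + u 1 + u 2) : ℤ) = 1 → Odd (u 0 + u 1 + u 2) := by
    intro u hu
    rw [← Int.not_even_iff_odd]
    rintro ⟨k, hk⟩
    rw [hk] at hu
    have : 2 * (u 0 * u 0 + u 1 * u 1 + u 2 * u 2 - 2 * k * k) = 1 := by linarith
    omega
  rw [B_eq] at hq hq'
  simp only [hz] at hq
  simp only [hw] at hq'
  obtain ⟨a, ha⟩ := odd z (by exact_mod_cast hq)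
  obtain ⟨b, hb⟩ := odd w (by exact_mod_cast hq')
  refine ⟨z 0 * w 0 + z 1 * w 1 + z 2 * w 2 - (2 * a * b + a + b + 1), ?_⟩
  have : B x y = ((2 * (z 0 * w 0 + z 1 * w 1 + z 2 * w 2)
    - (z 0 + z 1 + z 2) * (w 0 + w 1 + w 2) : ℤ) : ℝ) := by
    rw [B_eq]; simp only [hz, hw]; push_cast; ring
  rw [this, ha, hb]; push_cast; ring

lemma B_ge_or_le {x y : V} (hx : x ∈ Φ) (hy : y ∈ Φ) : 1 ≤ B x y ∨ B x y ≤ -1 := by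
  obtain ⟨n, hn⟩ := B_odd hx hy
  rw [hn]
  rcases le_or_gt 0 n with h | h
  · left; have : (0 : ℝ) ≤ n := by exact_mod_cast h
    linarith
  · right; have : (n : ℝ) ≤ -1 := by exact_mod_cast Int.le_sub_one_of_lt h
    linarith

lemma one_le_B_of_pos {x y : V} (hx : x ∈ Φ) (hy : y ∈ Φ) (h : 0 < B x y) : 1 ≤ B x y :=
  (B_ge_or_le hx hy).resolve_right (by linarith)

/-! ### The isotropic cone and decompositions of roots -/

lemma Oct.add {x y : V} (hx : Oct x) (hy : Oct y) : Oct (x + y) :=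
  fun i => add_nonneg (hx i) (hy i)

lemma Oct.smul {x : V} {r : ℝ} (hr : 0 ≤ r) (hx : Oct x) : Oct (r • x) :=
  fun i => mul_nonneg hr (hx i)

lemma Oct.eq_zero {x : V} (hx : Oct x) (h : ht x ≤ 0) : x = 0 := by
  have h0 := hx 0
  have h1 := hx 1
  have h2 := hx 2
  rw [ht] at h
  funext i
  fin_cases i <;> simp <;> linarith

lemma oct_or_of_B_nonpos {x : V} (hq : B x x ≤ 0) : Oct x ∨ Oct (-x) := by
  by_contra hcon
  rw [not_or] at hcon
  obtain ⟨h1, h2⟩ := hcon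
  simp only [Oct, not_forall, not_le] at h1
  obtain ⟨i, h1⟩ := h1
  refine h2 ((forall_fin_three i _).2 ?_)
  simp only [Pi.neg_apply, Left.nonneg_neg_iff]
  have e1 : B x x = (x (i + 1) - x i - x (i + 2)) ^ 2 - 4 * x i * x (i + 2) := by
    rw [B_self_eq x i]; ring
  have e2 : B x x = (x (i + 2) - x i - x (i + 1)) ^ 2 - 4 * x i * x (i + 1) := by
    rw [B_self_eq x i]; ring
  refine ⟨h1.le, ?_, ?_⟩
  · have : 0 ≤ x i * x (i + 1) := by nlinarith [sq_nonneg (x (i + 2) - x i - x (i + 1))]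
    nlinarith
  · have : 0 ≤ x i * x (i + 2) := by nlinarith [sq_nonneg (x (i + 1) - x i - x (i + 2))]
    nlinarith

lemma oct_of_B_nonpos {x : V} (hq : B x x ≤ 0) (hht : 0 ≤ ht x) : Oct x := by
  rcases oct_or_of_B_nonpos hq with h | h
  · exact h
  · have hz : -x = 0 := h.eq_zero (by
      rw [← neg_one_smul ℝ x, ht_smul]; linarith)
    rw [neg_eq_zero.1 hz]
    intro i; simp

lemma B_nonpos_of_oct {x y : V} (hx : Oct x) (hy : Oct y) (hqx : B x x ≤ 0) (hqy : B y y ≤ 0) :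
    B x y ≤ 0 := by
  have ex : (x 0 + x 1 - x 2) ^ 2 ≤ 4 * (x 0 * x 1) := by
    have : B x x = (x 0 + x 1 - x 2) ^ 2 - 4 * (x 0 * x 1) := by rw [B_eq]; ring
    linarith
  have ey : (y 0 + y 1 - y 2) ^ 2 ≤ 4 * (y 0 * y 1) := by
    have : B y y = (y 0 + y 1 - y 2) ^ 2 - 4 * (y 0 * y 1) := by rw [B_eq]; ring
    linarith
  have e : B x y = (x 0 + x 1 - x 2) * (y 0 + y 1 - y 2) - 2 * (x 0 * y 1 + x 1 * y 0) := by
    rw [B_eq]; ring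
  have hp : 0 ≤ 2 * (x 0 * y 1 + x 1 * y 0) := by
    have := mul_nonneg (hx 0) (hy 1)
    have := mul_nonneg (hx 1) (hy 0)
    linarith
  have : ((x 0 + x 1 - x 2) * (y 0 + y 1 - y 2)) ^ 2 ≤ (2 * (x 0 * y 1 + x 1 * y 0)) ^ 2 := by
    rw [mul_pow]
    calc _ ≤ 4 * (x 0 * x 1) * (4 * (y 0 * y 1)) :=
          mul_le_mul ex ey (sq_nonneg _) ((sq_nonneg _).trans ex)
      _ ≤ _ := by nlinarith [sq_nonneg (x 0 * y 1 - x 1 * y 0)]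
  have := abs_le_of_sq_le_sq' this hp
  linarith [this.2]

lemma oct_of_mem {x : V} (hx : x ∈ Φpos) : Oct x := (mem_Φpos_iff.1 hx).2.2

lemma B_self_of_mem {x : V} (hx : x ∈ Φ) : B x x = 1 := (mem_Φ_iff.1 hx).2

lemma ne_zero_of_mem_Φ {x : V} (hx : x ∈ Φ) : x ≠ 0 := by
  rintro rfl
  have := B_self_of_mem hx
  rw [B_zero_right] at this
  exact zero_ne_one this

lemma ht_pos {x : V} (hx : x ∈ Φpos) : 0 < ht x := by
  by_contra! h
  exact ne_zero_of_mem_Φ hx.1 ((oct_of_mem hx).eq_zero h)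

lemma one_le_ht {x : V} (hx : x ∈ Φpos) : 1 ≤ ht x := by
  obtain ⟨n, hn⟩ := (mem_Φpos_iff.1 hx).1.ht
  have := ht_pos hx
  rw [hn] at this ⊢
  exact_mod_cast this

lemma ht_neg (x : V) : ht (-x) = -ht x := by
  simp only [ht, Pi.neg_apply]; ring

lemma neg_notMem_Φpos {x : V} (hx : x ∈ Φpos) : -x ∉ Φpos := fun h => by
  have h1 := ht_pos hx
  have h2 := ht_pos h
  rw [ht_neg] at h2
  linarith

lemma two_mul_B_le_ht {w ρ : V} (hw : Oct w) (hq : B w w < 0) (hρ : ρ ∈ Φpos) (h : 0 ≤ B ρ w) :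
    2 * B ρ w ≤ ht w := by
  have hρ1 := B_self_of_mem hρ.1
  have hqr : B (rootRefl ρ w) (rootRefl ρ w) < 0 := by rwa [B_rootRefl hρ1]
  have ho : Oct (rootRefl ρ w) := by
    refine (oct_or_of_B_nonpos hqr.le).resolve_right fun hn => ?_
    have := B_nonpos_of_oct hw hn hq.le (by rw [B_neg_left, B_neg_right]; linarith)
    simp only [rootRefl, B_neg_right, B_sub_right, B_smul_right, B_comm w ρ] at this
    nlinarith
  have := ht_nonneg ho
  rw [rootRefl, ht_sub, ht_smul] at this
  nlinarith [one_le_ht hρ]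

/-- A positive root that pairs positively with a root of no larger height lies strictly
between that root and a root of smaller height. -/
lemma exists_split {a γ : V} (ha : a ∈ Φpos) (hγ : γ ∈ Φpos) (hne : a ≠ γ) (hB : 0 < B a γ)
    (hle : ht a ≤ ht γ) :
    ∃ ε ∈ Φpos, ∃ k l : ℝ, 0 < k ∧ 0 < l ∧ ht ε < ht γ ∧ γ = k • a + l • ε := by
  obtain ⟨hi, hq, ho⟩ := mem_Φpos_iff.1 ha
  revert ha hne hB hle
  refine ht_induction (p := fun a => a ∈ Φpos → a ≠ γ → 0 < B a γ → ht a ≤ ht γ →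
    ∃ ε ∈ Φpos, ∃ k l : ℝ, 0 < k ∧ 0 < l ∧ ht ε < ht γ ∧ γ = k • a + l • ε) ?_ hi ho
  intro a _ _ ih ha hne hB hle
  replace hB := one_le_B_of_pos ha.1 hγ.1 hB
  have qa := B_self_of_mem ha.1
  have qγ := B_self_of_mem hγ.1
  rcases mem_Φ_or (rootRefl_mem_Φ ha.1 hγ.1) with hr | hr
  · refine ⟨_, hr, 2 * B a γ, 1, by linarith, one_pos, ?_, ?_⟩
    · rw [rootRefl, ht_sub, ht_smul]
      nlinarith [ht_pos ha]
    · rw [rootRefl]; module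
  · set a' := -rootRefl a γ with ha'
    have ea : a' = (2 * B a γ) • a - γ := by rw [ha', rootRefl]; module
    have hBa : B a' a = B a γ := by
      rw [ea, B_sub_left, B_smul_left, qa, B_comm γ a]; ring
    have hBγ : B a' γ = 2 * B a γ ^ 2 - 1 := by
      rw [ea, B_sub_left, B_smul_left, qγ]; ring
    have qa' := B_self_of_mem hr.1
    have hlt : ht a' < ht a := by
      by_contra! hge
      have hx : B (γ - a) (γ - a) ≤ 0 := by
        simp only [B_sub_left, B_sub_right, qa, qγ, B_comm γ a]; linarith
      have hy : B (a' - a) (a' - a) ≤ 0 := by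
        simp only [B_sub_left, B_sub_right, qa, qa', B_comm a a', hBa]; linarith
      have ox := oct_of_B_nonpos hx (by rw [ht_sub]; linarith)
      have oy := oct_of_B_nonpos hy (by rw [ht_sub]; linarith)
      have hxy := B_nonpos_of_oct ox oy hx hy
      simp only [B_sub_left, B_sub_right, qa, B_comm a a', hBa, B_comm γ a', hBγ,
        B_comm γ a] at hxy
      have hone : B a γ = 1 := by nlinarith
      rw [hone] at ea
      have hh : ht a' = 2 * ht a - ht γ := by rw [ea, ht_sub, ht_smul]; ring
      exact hne (sub_eq_zero.1 (ox.eq_zero (by rw [ht_sub]; linarith))).symm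
    obtain ⟨ε, hε, k, l, hk, hl, hht, e⟩ := ih a' (mem_Φpos_iff.1 hr).1 (oct_of_mem hr) hlt hr
      (by rintro h; rw [h] at hlt; linarith) (by rw [hBγ]; nlinarith) (by linarith)
    refine ⟨ε, hε, 2 * B a γ * k / (1 + k), l / (1 + k), by positivity, by positivity, hht, ?_⟩
    have e2 : (1 + k) • γ = (2 * B a γ * k) • a + l • ε := by
      have h2 : k • a' = (2 * B a γ * k) • a - k • γ := by rw [ea]; module
      rw [h2] at e
      linear_combination (norm := module) e
    calc γ = (1 + k)⁻¹ • ((1 + k) • γ) := by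
          rw [smul_smul, inv_mul_cancel₀ (by positivity), one_smul]
      _ = (1 + k)⁻¹ • ((2 * B a γ * k) • a + l • ε) := by rw [e2]
      _ = (2 * B a γ * k / (1 + k)) • a + (l / (1 + k)) • ε := by module

/-- A non-simple positive root lies on a segment between two lower roots whose span is tangent to
the isotropic cone. -/
lemma exists_tangent {γ : V} (hγ : γ ∈ Φpos) (hns : ∀ i, γ ≠ α i) :
    ∃ δ ∈ Φpos, ∃ ε ∈ Φpos, ∃ s t : ℝ, 1 ≤ s ∧ 1 ≤ t ∧ γ = s • δ + t • ε ∧ B δ ε = -1 := by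
  obtain ⟨hi, hq, ho⟩ := mem_Φpos_iff.1 hγ
  revert hγ hns
  refine ht_induction (p := fun γ => γ ∈ Φpos → (∀ i, γ ≠ α i) →
    ∃ δ ∈ Φpos, ∃ ε ∈ Φpos, ∃ s t : ℝ, 1 ≤ s ∧ 1 ≤ t ∧ γ = s • δ + t • ε ∧ B δ ε = -1) ?_ hi ho
  intro γ hi ho ih hγ hns
  have hq := B_self_of_mem hγ.1
  obtain ⟨i, hpos⟩ := exists_B_α_pos ho (hq ▸ one_pos)
  have hone := one_le_B_of_pos (α_mem_Φ i) hγ.1 hpos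
  have qi := B_self_of_mem (α_mem_Φ i)
  have hoct : ∀ x ∈ Φpos, x ≠ α i → rootRefl (α i) x ∈ Φpos := fun x hx hne =>
    mem_Φpos_iff.2 ⟨(intVec_α i).rootRefl (mem_Φpos_iff.1 hx).1,
      (B_rootRefl qi x x).trans (B_self_of_mem hx.1),
      oct_rootRefl_α (mem_Φpos_iff.1 hx).1 (B_self_of_mem hx.1) (oct_of_mem hx) i hne⟩
  have hα : ∀ j, α j ∈ Φpos := fun j =>
    mem_Φpos_iff.2 ⟨intVec_α j, B_α_self j, fun l => by rw [α_apply]; split_ifs <;> simp⟩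
  have hγ' := hoct γ hγ (hns i)
  have eγ := rootRefl_rootRefl qi γ
  by_cases hsimp : ∃ j, rootRefl (α i) γ = α j
  · obtain ⟨j, hj⟩ := hsimp
    rw [hj] at eγ
    have hij : i ≠ j := by
      rintro rfl
      have : γ = -α i := by rw [← eγ, rootRefl, qi]; module
      exact neg_notMem_Φpos (hα i) (this ▸ hγ)
    have hB : B (α i) (α j) = -1 := by
      rw [B_α, α_apply, if_neg hij]
      fin_cases j <;> simp [ht, α]
    refine ⟨α j, hα j, α i, hα i, 1, 2, le_rfl, by norm_num, ?_, by rw [B_comm, hB]⟩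
    rw [← eγ, rootRefl, hB]; module
  · push Not at hsimp
    obtain ⟨δ, hδ, ε, hε, s, t, hs, ht', e, hB⟩ := ih _ ((intVec_α i).rootRefl hi)
      (oct_of_mem hγ') (by rw [ht_rootRefl_α]; linarith) hγ' hsimp
    rw [e] at eγ
    by_cases h1 : δ = α i
    · have hB' : B (α i) ε = -1 := h1 ▸ hB
      have e' : γ = (2 * t - s) • α i + t • ε := by
        rw [← eγ, rootRefl, B_add_right, B_smul_right, B_smul_right, hB', h1, qi]; module
      refine ⟨α i, hα i, ε, hε, 2 * t - s, t, ?_, ht', e', hB'⟩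
      rw [e', B_add_right, B_smul_right, B_smul_right, hB', qi] at hone
      linarith
    by_cases h2 : ε = α i
    · have hB' : B (α i) δ = -1 := by rw [B_comm, ← h2, hB]
      have e' : γ = s • δ + (2 * s - t) • α i := by
        rw [← eγ, rootRefl, B_add_right, B_smul_right, B_smul_right, hB', h2, qi]; module
      refine ⟨δ, hδ, α i, hα i, s, 2 * s - t, hs, ?_, e', by rw [B_comm, hB']⟩
      rw [e', B_add_right, B_smul_right, B_smul_right, hB', qi] at hone
      linarith
    refine ⟨_, hoct δ hδ h1, _, hoct ε hε h2, s, t, hs, ht', ?_, by rw [B_rootRefl qi, hB]⟩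
    rw [← eγ]
    simp only [rootRefl, B_add_right, B_smul_right]
    module

lemma ht_lt_of_tangent {γ δ ε : V} {s t : ℝ} (hδ : δ ∈ Φpos) (hε : ε ∈ Φpos) (hs : 1 ≤ s)
    (ht' : 1 ≤ t) (e : γ = s • δ + t • ε) : ht δ < ht γ ∧ ht ε < ht γ := by
  rw [e, ht_add, ht_smul, ht_smul]
  have := ht_pos hδ
  have := ht_pos hε
  constructor <;> nlinarith

/-- Roots strictly above the tangent plane pair positively with `γ` and are lower than `γ`. -/
lemma above_tangent {γ δ ε ρ : V} {s t : ℝ} (hγ : γ ∈ Φpos) (hδ : δ ∈ Φpos) (hε : ε ∈ Φpos)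
    (hB : B δ ε = -1) (e : γ = s • δ + t • ε) (hρ : ρ ∈ Φpos) (hpos : 0 < B (δ + ε) ρ) :
    0 < B ρ γ ∧ ht ρ < ht γ := by
  have qδ := B_self_of_mem hδ.1
  have qε := B_self_of_mem hε.1
  have qρ := B_self_of_mem hρ.1
  have qγ := B_self_of_mem hγ.1
  have hcγ : B (δ + ε) γ = 0 := by
    rw [e]
    simp only [B_add_left, B_add_right, B_smul_right, hB, B_comm ε δ, qδ, qε]; ring
  have qc : B (δ + ε) (δ + ε) ≤ 0 := by
    simp only [B_add_left, B_add_right, hB, B_comm ε δ, qδ, qε]; norm_num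
  have oc : Oct (δ + ε) := (oct_of_mem hδ).add (oct_of_mem hε)
  have hB1 : 1 ≤ B ρ γ := by
    refine (B_ge_or_le hρ.1 hγ.1).resolve_right fun hle => ?_
    have := B_nonpos_of_oct oc ((oct_of_mem hρ).add (oct_of_mem hγ)) qc
      (by simp only [B_add_left, B_add_right, B_comm γ ρ, qγ, qρ]; linarith)
    rw [B_add_right, hcγ] at this
    linarith
  refine ⟨by linarith, ?_⟩
  by_contra! hge
  have hq : B (ρ - γ) (ρ - γ) ≤ 0 := by
    simp only [B_sub_left, B_sub_right, B_comm γ ρ, qγ, qρ]; linarith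
  have := B_nonpos_of_oct oc (oct_of_B_nonpos hq (by rw [ht_sub]; linarith)) qc hq
  rw [B_sub_right, hcγ] at this
  linarith

/-! ### Roots as edges of the Farey tessellation -/

/-- The determinant of two integer vectors. -/
def det2 (a b : ℤ × ℤ) : ℤ := a.1 * b.2 - a.2 * b.1

/-- The polarisation of `(m, n) ↦ (n², m², (m - n)²)`, which identifies null directions with
rational points of the projective line. -/
def sy (a b : ℤ × ℤ) : V :=
  ![((a.2 * b.2 : ℤ) : ℝ), ((a.1 * b.1 : ℤ) : ℝ), (((a.1 - a.2) * (b.1 - b.2) : ℤ) : ℝ)]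

lemma sy_comm (a b : ℤ × ℤ) : sy a b = sy b a := by
  simp only [sy, mul_comm]

lemma sy_neg_neg (a b : ℤ × ℤ) : sy (-a) (-b) = sy a b := by
  funext i
  fin_cases i <;> simp [sy]
  ring

lemma sy_add_right (a b c : ℤ × ℤ) : sy a (b + c) = sy a b + sy a c := by
  funext i
  fin_cases i <;> simp [sy] <;> ring

lemma sy_add_left (a b c : ℤ × ℤ) : sy (a + b) c = sy a c + sy b c := by
  funext i
  fin_cases i <;> simp [sy] <;> ring

lemma B_sy (a b c d : ℤ × ℤ) :
    B (sy a b) (sy c d) = -(det2 a c * det2 b d + det2 a d * det2 b c : ℤ) := by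
  simp [B_eq, sy, det2]; ring

lemma det2_self (a : ℤ × ℤ) : det2 a a = 0 := by simp only [det2]; ring

lemma det2_swap (a b : ℤ × ℤ) : det2 a b = -det2 b a := by simp only [det2]; ring

lemma det2_neg_right (a b : ℤ × ℤ) : det2 a (-b) = -det2 a b := by
  simp only [det2, Prod.fst_neg, Prod.snd_neg]; ring

lemma det2_neg_left (a b : ℤ × ℤ) : det2 (-a) b = -det2 a b := by
  simp only [det2, Prod.fst_neg, Prod.snd_neg]; ring

lemma det2_add_right (a b c : ℤ × ℤ) : det2 a (b + c) = det2 a b + det2 a c := by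
  simp only [det2, Prod.fst_add, Prod.snd_add]; ring

lemma det2_add_left (a b c : ℤ × ℤ) : det2 (a + b) c = det2 a c + det2 b c := by
  simp only [det2, Prod.fst_add, Prod.snd_add]; ring

lemma intVec_sy (a b : ℤ × ℤ) : IntVec (sy a b) :=
  ⟨![a.2 * b.2, a.1 * b.1, (a.1 - a.2) * (b.1 - b.2)], fun i => by fin_cases i <;> rfl⟩

lemma oct_sy_self (a : ℤ × ℤ) : Oct (sy a a) := by
  intro i
  fin_cases i <;> simp only [sy] <;> exact Int.cast_nonneg (mul_self_nonneg _)

lemma B_sy_self {a b : ℤ × ℤ} (h : det2 a b = 1) : B (sy a b) (sy a b) = 1 := by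
  rw [B_sy, det2_self, det2_swap b a, h]; simp

/-- The edges of the Farey tessellation whose root lies in `S`. -/
def Edge (S : Set V) (a b : ℤ × ℤ) : Prop := det2 a b = 1 ∧ sy a b ∈ S

lemma Edge.neg {S : Set V} {a b : ℤ × ℤ} (h : Edge S a b) : Edge S (-a) (-b) :=
  ⟨by rw [det2_neg_left, det2_neg_right, neg_neg, h.1], by rw [sy_neg_neg]; exact h.2⟩

/-- `ρ` is separated from the opposite side by the edge `(a, b)`, with coordinate sum at
most `k`. -/
def Under (k : ℕ) (ρ : V) (a b : ℤ × ℤ) : Prop :=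
  ∃ x y z : ℕ, x + y + z ≤ k ∧ ρ = (x : ℝ) • sy a b + (y : ℝ) • sy a a + (z : ℝ) • sy b b

lemma Under.neg {k : ℕ} {ρ : V} {a b : ℤ × ℤ} (h : Under k ρ a b) : Under k ρ (-a) (-b) := by
  simpa only [Under, sy_neg_neg] using h

lemma Under.coords {k : ℕ} {ρ : V} {a b : ℤ × ℤ} (h : Under k ρ a b) (hab : det2 a b = 1)
    (hρ : B ρ ρ = 1) : ∃ x y z : ℕ, x + y + z ≤ k ∧
      ρ = (x : ℝ) • sy a b + (y : ℝ) • sy a a + (z : ℝ) • sy b b ∧ x * x = 1 + 4 * (y * z) := by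
  obtain ⟨x, y, z, hk, rfl⟩ := h
  refine ⟨x, y, z, hk, rfl, ?_⟩
  simp only [B_add_left, B_add_right, B_smul_left, B_smul_right, B_sy, det2_self,
    det2_swap b a, hab] at hρ
  have : ((x * x : ℕ) : ℝ) = ((1 + 4 * (y * z) : ℕ) : ℝ) := by
    push_cast at hρ ⊢; linarith
  exact_mod_cast this

lemma Under.B_pos {k : ℕ} {ρ : V} {a b : ℤ × ℤ} (h : Under k ρ a b) (hab : det2 a b = 1)
    (hρ : B ρ ρ = 1) : 0 < B (sy a b) ρ := by
  obtain ⟨x, y, z, -, rfl, e⟩ := h.coords hab hρ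
  simp only [B_add_right, B_smul_right, B_sy, det2_self, det2_swap b a, hab]
  have : 0 < x := by
    rcases Nat.eq_zero_or_pos x with rfl | h
    · omega
    · exact h
  have : (0 : ℝ) < x := by exact_mod_cast this
  push_cast; linarith

lemma Under.split {k : ℕ} {ρ : V} {a b : ℤ × ℤ} (h : Under k ρ a b) (hab : det2 a b = 1)
    (hρ : B ρ ρ = 1) (hne : ρ ≠ sy a b) :
    ∃ k' < k, Under k' ρ a (a + b) ∨ Under k' ρ (a + b) b := by
  obtain ⟨x, y, z, hk, e, hx⟩ := h.coords hab hρ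
  have hx0 : 0 < x := Nat.pos_of_ne_zero (by rintro rfl; omega)
  have aux : ∀ y z : ℕ, x * x = 1 + 4 * (y * z) → z < y → 2 * z ≤ x ∧ x ≤ y + z := by
    intro y z hx hlt
    obtain ⟨d, rfl⟩ := Nat.exists_eq_add_of_lt hlt
    constructor <;> by_contra! hcon <;> nlinarith
  rcases lt_trichotomy z y with hlt | rfl | hlt
  · obtain ⟨h1, h2⟩ := aux y z hx hlt
    refine ⟨y, by omega, Or.inl ⟨x - 2 * z, y + z - x, z, by omega, ?_⟩⟩
    rw [e]
    push_cast [h1, h2]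
    simp only [sy_add_right, sy_add_left, sy_comm b a]
    module
  · refine absurd ?_ hne
    obtain rfl : z = 0 := by
      by_contra hz
      have : 2 * z < x ∧ x < 2 * z + 1 := by
        constructor <;> by_contra! hcon <;> nlinarith [Nat.pos_of_ne_zero hz]
      omega
    obtain rfl : x = 1 := by nlinarith
    rw [e]; simp
  · obtain ⟨h1, h2⟩ := aux z y (by rw [hx, mul_comm y z]) hlt
    refine ⟨z, by omega, Or.inr ⟨x - 2 * y, y, z + y - x, by omega, ?_⟩⟩
    rw [e]
    push_cast [h1, h2]
    simp only [sy_add_right, sy_add_left, sy_comm b a]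
    module

lemma Under.mono {k l : ℕ} {ρ : V} {a b : ℤ × ℤ} (h : Under k ρ a b) (hkl : k ≤ l) :
    Under l ρ a b := by
  obtain ⟨x, y, z, hk, e⟩ := h
  exact ⟨x, y, z, hk.trans hkl, e⟩

lemma sy_left_child_mem {a b : ℤ × ℤ} (h : Edge Φpos a b) : Edge Φpos a (a + b) := by
  have hd : det2 a (a + b) = 1 := by rw [det2_add_right, det2_self, h.1, zero_add]
  refine ⟨hd, mem_Φpos_iff.2 ⟨intVec_sy _ _, B_sy_self hd, ?_⟩⟩
  rw [sy_add_right]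
  exact (oct_sy_self a).add (oct_of_mem h.2)

lemma sy_right_child_mem {a b : ℤ × ℤ} (h : Edge Φpos a b) : Edge Φpos (a + b) b := by
  have hd : det2 (a + b) b = 1 := by rw [det2_add_left, det2_self, h.1, add_zero]
  refine ⟨hd, mem_Φpos_iff.2 ⟨intVec_sy _ _, B_sy_self hd, ?_⟩⟩
  rw [sy_add_left]
  exact (oct_of_mem h.2).add (oct_sy_self b)

lemma fan_mem {S : Set V} (hS : S ⊆ Φpos) (hc : IsClosedSet S) {u v p : V} {k : ℝ} (hu : u ∈ S)
    (hv : v ∈ S) (hp : Oct p) (e : u + v = k • p) (hvp : v + p ∈ Φpos) : v + p ∈ S := by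
  have hk : 0 < k := by
    by_contra! hk
    have := congrArg ht e
    rw [ht_add, ht_smul] at this
    nlinarith [ht_pos (hS hu), ht_pos (hS hv), ht_nonneg hp]
  refine hc u hu v hv ⟨mem_nnspan_pair.2 ⟨k⁻¹, 1 + k⁻¹, by positivity, by positivity, ?_⟩, hvp⟩
  have : p = k⁻¹ • (u + v) := by rw [e, smul_smul, inv_mul_cancel₀ hk.ne', one_smul]
  rw [this]; module

lemma sy_vertex {x a b : ℤ × ℤ} (hxa : det2 x a = 1) (hab : det2 a b = 1) :
    sy x a + sy a b = (det2 x b : ℝ) • sy a a := by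
  have h1 : (x.1 : ℝ) * a.2 - x.2 * a.1 = 1 := by exact_mod_cast hxa
  have h2 : (a.1 : ℝ) * b.2 - a.2 * b.1 = 1 := by exact_mod_cast hab
  have e1 : (x.1 + b.1 : ℝ) = (x.1 * b.2 - x.2 * b.1) * a.1 := by
    linear_combination (-(x.1 : ℝ)) * h2 - b.1 * h1
  have e2 : (x.2 + b.2 : ℝ) = (x.1 * b.2 - x.2 * b.1) * a.2 := by
    linear_combination (-(x.2 : ℝ)) * h2 - b.2 * h1
  funext i
  fin_cases i <;> simp [sy, det2]
  · linear_combination (a.2 : ℝ) * e2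
  · linear_combination (a.1 : ℝ) * e1
  · linear_combination (a.1 - a.2 : ℝ) * (e1 - e2)

lemma left_child_mem {S : Set V} (hS : S ⊆ Φpos) (hc : IsClosedSet S) {x a b : ℤ × ℤ}
    (h1 : Edge S x a) (h2 : Edge S a b) : Edge S a (a + b) := by
  have h := sy_left_child_mem ⟨h2.1, hS h2.2⟩
  refine ⟨h.1, ?_⟩
  have h' := h.2
  rw [sy_add_right, add_comm] at h' ⊢
  exact fan_mem hS hc h1.2 h2.2 (oct_sy_self a) (sy_vertex h1.1 h2.1) h'

lemma right_child_mem {S : Set V} (hS : S ⊆ Φpos) (hc : IsClosedSet S) {a b y : ℤ × ℤ}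
    (h1 : Edge S a b) (h2 : Edge S b y) : Edge S (a + b) b := by
  have h := sy_right_child_mem ⟨h1.1, hS h1.2⟩
  refine ⟨h.1, ?_⟩
  have h' := h.2
  rw [sy_add_left] at h' ⊢
  exact fan_mem hS hc h2.2 h1.2 (oct_sy_self b) (by rw [add_comm, sy_vertex h1.1 h2.1]) h'

lemma under_mem {S : Set V} (hS : S ⊆ Φpos) (hc : IsClosedSet S) {k : ℕ} {ρ : V} (hρ : ρ ∈ Φpos)
    {x a b y : ℤ × ℤ} (h1 : Edge S x a) (h2 : Edge S a b) (h3 : Edge S b y)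
    (h : Under k ρ a b) : ρ ∈ S := by
  induction k using Nat.strong_induction_on generalizing x a b y with
  | _ k ih =>
    by_cases hne : ρ = sy a b
    · exact hne ▸ h2.2
    have hl := left_child_mem hS hc h1 h2
    have hr := right_child_mem hS hc h2 h3
    obtain ⟨k', hk, h | h⟩ := h.split h2.1 (B_self_of_mem hρ.1) hne
    · exact ih k' hk h1 hl hr h
    · exact ih k' hk hl hr h3 h

lemma isChain_not_under {S : Set V} (hS : S ⊆ Φpos) (hc : IsClosedSet S) {k : ℕ} {ρ : V}
    (hρ : ρ ∈ Φpos) (hρS : ρ ∉ S) {w w' : ℤ × ℤ} {L : List (ℤ × ℤ)}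
    (h : (w :: (L ++ [w'])).IsChain (Edge S)) :
    L.IsChain fun a b => ¬ Under k ρ a b := by
  induction L generalizing w with
  | nil => simp
  | cons a L ih =>
    cases L with
    | nil => simp
    | cons b L =>
      rw [List.isChain_cons_cons]
      simp only [List.cons_append, List.isChain_cons_cons] at h ih
      refine ⟨fun hu => hρS ?_, ih h.2⟩
      cases L with
      | nil => 
        simp only [List.nil_append, List.isChain_cons_cons] at h
        exact under_mem hS hc hρ h.1 h.2.1 h.2.2.1 hu
      | cons y L =>
        simp only [List.cons_append, List.isChain_cons_cons] at h
        exact under_mem hS hc hρ h.1 h.2.1 h.2.2.1 hu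

lemma sy_neg_right (a b : ℤ × ℤ) : sy a (-b) = -sy a b := by
  funext i
  fin_cases i <;> simp [sy]
  ring

lemma exists_of_not_isChain {β : Type*} {r : β → β → Prop} {L : List β} (h : ¬ L.IsChain r) :
    ∃ X a b Y, L = X ++ a :: b :: Y ∧ ¬ r a b := by
  induction L with
  | nil => simp at h
  | cons a L ih =>
    cases L with
    | nil => simp at h
    | cons b L =>
      by_cases hab : r a b
      · rw [List.isChain_cons_cons, not_and] at h
        obtain ⟨X, c, d, Y, e, hcd⟩ := ih (h hab)
        exact ⟨a :: X, c, d, Y, by rw [e, List.cons_append], hcd⟩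
      · exact ⟨[], a, b, L, rfl, hab⟩

/-- A Farey polygon cut into two arcs: the edges of the path `LA` from `p` to `q` belong to `S`
and those of the path `LB` from `q` to `-p` belong to `T`. -/
structure FareyArcs (S T : Set V) (p q : ℤ × ℤ) (LA LB : List (ℤ × ℤ)) : Prop where
  headA : LA.head? = some p
  lastA : LA.getLast? = some q
  headB : LB.head? = some q
  lastB : LB.getLast? = some (-p)
  chainA : LA.IsChain (Edge S)
  chainB : LB.IsChain (Edge T)
  pairwise : (LA ++ LB).Pairwise fun u v => 0 ≤ det2 u v
  pos : 0 < det2 p q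

/-- Closed complementary sets `S`, `T` with finite subsets `S'`, `T'` that pair negatively. -/
structure CrossNeg (S T : Set V) (S' T' : Finset V) : Prop where
  subS : S ⊆ Φpos
  subT : T ⊆ Φpos
  closedS : IsClosedSet S
  closedT : IsClosedSet T
  cover : ∀ x ∈ Φpos, x ∈ S ∨ x ∈ T
  disj : ∀ x ∈ S, x ∉ T
  memS : ∀ x ∈ S', x ∈ S
  memT : ∀ x ∈ T', x ∈ T
  nonemptyS : S'.Nonempty
  nonemptyT : T'.Nonempty
  neg : ∀ x ∈ S', ∀ y ∈ T', B x y < 0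

lemma CrossNeg.symm {S T : Set V} {S' T' : Finset V} (h : CrossNeg S T S' T') :
    CrossNeg T S T' S' :=
  ⟨h.subT, h.subS, h.closedT, h.closedS, fun x hx => (h.cover x hx).symm,
    fun x hx hx' => h.disj x hx' hx, h.memT, h.memS, h.nonemptyT, h.nonemptyS,
    fun x hx y hy => by rw [B_comm]; exact h.neg y hy x hx⟩

lemma FareyArcs.symm {S T : Set V} {p q : ℤ × ℤ} {LA LB : List (ℤ × ℤ)}
    (h : FareyArcs S T p q LA LB) :
    FareyArcs T S q (-p) LB (LA.map fun u => -u) where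
  headA := h.headB
  lastA := h.lastB
  headB := by simp [h.headA]
  lastB := by simp [h.lastA]
  chainA := h.chainB
  chainB := by
    rw [List.isChain_map]
    exact h.chainA.imp fun _ _ => Edge.neg
  pairwise := by
    have := h.pairwise
    rw [List.pairwise_append] at this ⊢
    refine ⟨this.2.1, ?_, fun u hu v hv => ?_⟩
    · rw [List.pairwise_map]
      exact this.1.imp fun {a b} hab => by rwa [det2_neg_left, det2_neg_right, neg_neg]
    · obtain ⟨w, hw, rfl⟩ := List.mem_map.1 hv
      rw [det2_neg_right, ← det2_swap]
      exact this.2.2 w hw u hu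
  pos := by rw [det2_neg_right, ← det2_swap]; exact h.pos

lemma FareyArcs.B_pos {S T : Set V} {p q : ℤ × ℤ} {LA LB : List (ℤ × ℤ)}
    (h : FareyArcs S T p q LA LB)
    {a b : ℤ × ℤ} (ha : a ∈ LA) (hb : b ∈ LA) (hab : det2 a b = 1) {k : ℕ} {ρ : V}
    (hρ : B ρ ρ = 1) (hu : Under k ρ a b) : 0 < B (sy p q) ρ := by
  obtain ⟨x, y, z, -, rfl, e⟩ := hu.coords hab hρ
  have hx : 0 < x := Nat.pos_of_ne_zero (by rintro rfl; omega)
  have hcross := (List.pairwise_append.1 h.pairwise).2.2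
  have hq : q ∈ LB := List.mem_of_mem_head? h.headB
  have hp : -p ∈ LB := List.mem_of_getLast? h.lastB
  have haq := hcross a ha q hq
  have hbq := hcross b hb q hq
  have hap := hcross a ha _ hp
  have hbp := hcross b hb _ hp
  rw [det2_neg_right, ← det2_swap] at hap hbp
  have hpq := h.pos
  have hpl : det2 p q * det2 a b = det2 p a * det2 b q * (-1) + det2 p b * det2 a q := by
    simp only [det2]; ring
  have h1 : 0 ≤ det2 p a * det2 a q := mul_nonneg hap haq
  have h2 : 0 ≤ det2 p b * det2 b q := mul_nonneg hbp hbq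
  have h3 : 0 ≤ det2 p a * det2 b q := mul_nonneg hap hbq
  have h4 : 0 ≤ det2 p b * det2 a q := mul_nonneg hbp haq
  have h5 : 0 < det2 p a * det2 b q + det2 p b * det2 a q := by
    rw [hab, mul_one] at hpl; linarith
  simp only [B_add_right, B_smul_right, B_sy, det2_swap q]
  have h1' : (0 : ℝ) ≤ det2 p a * det2 a q := by exact_mod_cast h1
  have h2' : (0 : ℝ) ≤ det2 p b * det2 b q := by exact_mod_cast h2
  have h5' : (0 : ℝ) < det2 p a * det2 b q + det2 p b * det2 a q := by exact_mod_cast h5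
  have hx' : (0 : ℝ) < x := by exact_mod_cast hx
  push_cast
  nlinarith [mul_pos hx' h5', mul_nonneg (Nat.cast_nonneg (α := ℝ) y) h1',
    mul_nonneg (Nat.cast_nonneg (α := ℝ) z) h2']

lemma pairwise_insert {X Y : List (ℤ × ℤ)} {a b : ℤ × ℤ}
    (h : (X ++ a :: b :: Y).Pairwise fun u v => 0 ≤ det2 u v) :
    (X ++ a :: (a + b) :: b :: Y).Pairwise fun u v => 0 ≤ det2 u v := by
  simp only [List.pairwise_append, List.pairwise_cons, List.mem_cons, forall_eq_or_imp] at h ⊢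
  obtain ⟨hX, ⟨⟨hab, ha⟩, hb, hY⟩, hXY⟩ := h
  refine ⟨hX, ⟨⟨?_, hab, ha⟩, ⟨?_, fun y hy => ?_⟩, hb, hY⟩, fun u hu => ?_⟩
  · rwa [det2_add_right, det2_self, zero_add]
  · rwa [det2_add_left, det2_self, add_zero]
  · rw [det2_add_left]
    exact add_nonneg (ha y hy) (hb y hy)
  · obtain ⟨h1, h2, h3⟩ := hXY u hu
    exact ⟨h1, by rw [det2_add_right]; exact add_nonneg h1 h2, h2, h3⟩

lemma pairwise_double {X Y : List (ℤ × ℤ)} {a : ℤ × ℤ}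
    (h : (X ++ a :: Y).Pairwise fun u v => 0 ≤ det2 u v) :
    (X ++ a :: a :: Y).Pairwise fun u v => 0 ≤ det2 u v := by
  simp only [List.pairwise_append, List.pairwise_cons, List.mem_cons, forall_eq_or_imp] at h ⊢
  obtain ⟨hX, ⟨ha, hY⟩, hXY⟩ := h
  exact ⟨hX, ⟨⟨(det2_self a).ge, ha⟩, ha, hY⟩, fun u hu => ⟨(hXY u hu).1, hXY u hu⟩⟩

lemma pairwise_rotate {Y : List (ℤ × ℤ)} {a b : ℤ × ℤ}
    (h : (a :: b :: Y).Pairwise fun u v => 0 ≤ det2 u v) :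
    ((a + b) :: b :: (Y ++ [-(a + b)])).Pairwise fun u v => 0 ≤ det2 u v := by
  simp only [List.pairwise_append, List.pairwise_cons, List.mem_cons, List.mem_append,
    List.mem_nil_iff, or_false, or_imp, forall_and, forall_eq] at h ⊢
  obtain ⟨⟨hab, ha⟩, hb, hY⟩ := h
  have hn : ∀ y ∈ Y, 0 ≤ det2 (a + b) y := fun y hy => by
    rw [det2_add_left]
    exact add_nonneg (ha y hy) (hb y hy)
  refine ⟨⟨?_, hn, ?_⟩, ⟨hb, ?_⟩, hY, by simp, fun y hy => ?_⟩
  · rwa [det2_add_left, det2_self, add_zero]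
  · rw [det2_neg_right, det2_self, neg_zero]
  · rwa [det2_neg_right, ← det2_swap, det2_add_left, det2_self, add_zero]
  · rw [det2_neg_right, ← det2_swap]
    exact hn y hy

/-- Property of a relation on vertices expressing that the two children of the edge `(a, b)`
refine the polygon with arcs `LA` and `LB`. -/
def Subdivides (a b : ℤ × ℤ) (LA LB : List (ℤ × ℤ)) (r : ℤ × ℤ → ℤ × ℤ → Prop) : Prop :=
  r a (a + b) ∧ r (a + b) b ∧ (r a b → LA.IsChain r ∧ LB.IsChain r)

lemma FareyArcs.subdivide {S T : Set V} {S' T' : Finset V} (hST : CrossNeg S T S' T') {p q : ℤ × ℤ}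
    {LA LB : List (ℤ × ℤ)} (h : FareyArcs S T p q LA LB) {X Y : List (ℤ × ℤ)} {a b : ℤ × ℤ}
    (hL : LA = X ++ a :: b :: Y) :
    (∃ p' q' LA' LB', FareyArcs S T p' q' LA' LB' ∧ ∀ r : ℤ × ℤ → ℤ × ℤ → Prop,
      (∀ u v, r (-u) (-v) → r u v) → LA'.IsChain r → LB'.IsChain r →
        Subdivides a b LA LB r) ∨
    ∀ k ρ, ρ ∈ Φpos → ρ ∉ T → Subdivides a b LA LB fun u v => ¬ Under k ρ u v := by
  subst hL
  have hcA := h.chainA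
  rw [List.isChain_append_cons_cons] at hcA
  obtain ⟨hcX, hab, hcY⟩ := hcA
  have hab' : Edge Φpos a b := ⟨hab.1, hST.subS hab.2⟩
  have hl := sy_left_child_mem hab'
  have hr := sy_right_child_mem hab'
  have edgeT : ∀ {u v}, Edge Φpos u v → ¬ Edge S u v → Edge T u v := fun {u v} h1 h2 =>
    ⟨h1.1, (hST.cover _ h1.2).resolve_left fun h3 => h2 ⟨h1.1, h3⟩⟩
  have hX : ¬ Edge S a (a + b) → X = [] := by
    intro hn
    rcases List.eq_nil_or_concat' X with rfl | ⟨X, x, rfl⟩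
    · rfl
    · rw [List.append_assoc, List.singleton_append, List.isChain_append_cons_cons] at hcX
      exact absurd (left_child_mem hST.subS hST.closedS hcX.2.1 hab) hn
  have hY : ¬ Edge S (a + b) b → Y = [] := by
    intro hn
    cases Y with
    | nil => rfl
    | cons y Y =>
      exact absurd (right_child_mem hST.subS hST.closedS hab (List.isChain_cons_cons.1 hcY).1) hn
  have hpw := h.pairwise
  have hcross := (List.pairwise_append.1 hpw).2.2
  by_cases h1 : Edge S a (a + b) <;> by_cases h2 : Edge S (a + b) b
  · left
    refine ⟨p, q, X ++ a :: (a + b) :: b :: Y, LB, ⟨?_, ?_, h.headB, h.lastB, ?_, h.chainB, ?_,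
      h.pos⟩, fun r _ hA hB => ?_⟩
    · have := h.headA
      cases X <;> simpa using this
    · have := h.lastA
      simpa [List.getLast?_append, List.getLast?_cons_cons] using this
    · rw [List.isChain_append_cons_cons, List.isChain_cons_cons]
      exact ⟨hcX, h1, h2, hcY⟩
    · rw [List.append_assoc] at hpw ⊢
      exact pairwise_insert hpw
    · rw [List.isChain_append_cons_cons, List.isChain_cons_cons] at hA
      refine ⟨hA.2.1, hA.2.2.1, fun hr => ⟨?_, hB⟩⟩
      rw [List.isChain_append_cons_cons]
      exact ⟨hA.1, hr, hA.2.2.2⟩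
  · left
    obtain rfl := hY h2
    obtain rfl : b = q := by
      have := h.lastA
      simpa [List.getLast?_append, List.getLast?_cons_cons] using this
    have hpa : 0 ≤ det2 p a := by
      have := hcross a (by simp) _ (List.mem_of_getLast? h.lastB)
      rwa [det2_neg_right, ← det2_swap] at this
    refine ⟨p, a + b, X ++ [a, a + b], (a + b) :: LB, ⟨?_, ?_, ?_, ?_, ?_, ?_, ?_, ?_⟩,
      fun r _ hA hB => ?_⟩
    · have := h.headA
      cases X <;> simpa using this
    · simp [List.getLast?_append, List.getLast?_cons_cons]
    · rfl
    · have := h.lastB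
      cases LB <;> simp_all [List.getLast?_cons_cons]
    · rw [List.isChain_append_cons_cons]
      exact ⟨hcX, h1, by simp⟩
    · have := h.headB
      cases LB with
      | nil => simp at this
      | cons c LB =>
        obtain rfl : c = b := by simpa using this
        exact List.isChain_cons_cons.2 ⟨edgeT hr h2, h.chainB⟩
    · have := h.headB
      cases LB with
      | nil => simp at this
      | cons c LB =>
        obtain rfl : c = b := by simpa using this
        simp only [List.append_assoc, List.cons_append, List.nil_append] at hpw ⊢
        refine List.append_cons X a _ ▸ pairwise_double (X := X ++ [a]) ?_
        rw [List.append_assoc]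
        exact pairwise_insert (hpw.sublist (by simp))
    · rw [det2_add_right]
      linarith [h.pos]
    · rw [List.isChain_append_cons_cons] at hA
      have := h.headB
      cases LB with
      | nil => simp at this
      | cons c LB =>
        obtain rfl : c = b := by simpa using this
        rw [List.isChain_cons_cons] at hB
        refine ⟨hA.2.1, hB.1, fun hr => ⟨?_, hB.2⟩⟩
        rw [List.isChain_append_cons_cons]
        exact ⟨hA.1, hr, by simp⟩
  · left
    obtain rfl := hX h1
    obtain rfl : a = p := by simpa using h.headA
    have hbq : 0 ≤ det2 b q := hcross b (by simp) q (List.mem_of_mem_head? h.headB)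
    refine ⟨a + b, q, (a + b) :: b :: Y, LB ++ [-(a + b)], ⟨?_, ?_, ?_, ?_, ?_, ?_, ?_, ?_⟩,
      fun r hneg hA hB => ?_⟩
    · rfl
    · simpa [List.getLast?_cons_cons] using h.lastA
    · have := h.headB
      cases LB <;> simp_all
    · simp
    · exact List.isChain_cons_cons.2 ⟨h2, hcY⟩
    · rw [List.isChain_append]
      refine ⟨h.chainB, by simp, fun u hu v hv => ?_⟩
      rw [h.lastB] at hu
      obtain rfl : -a = u := by simpa using hu
      obtain rfl : -(a + b) = v := by simpa using hv
      exact (edgeT hl h1).neg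
    · rw [List.nil_append, List.cons_append, List.cons_append] at hpw
      simpa using pairwise_rotate hpw
    · rw [det2_add_left]
      linarith [h.pos]
    · rw [List.isChain_append] at hB
      refine ⟨hneg _ _ (hB.2.2 _ h.lastB _ rfl), (List.isChain_cons_cons.1 hA).1,
        fun hr => ⟨?_, hB.1⟩⟩
      exact List.isChain_cons_cons.2 ⟨hr, (List.isChain_cons_cons.1 hA).2⟩
  · right
    intro k ρ hρ hρT
    obtain rfl := hX h1
    obtain rfl := hY h2
    obtain rfl : a = p := by simpa using h.headA
    obtain rfl : b = q := by simpa using h.lastA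
    have hch : (a :: (((a + b) :: LB ++ [-(a + b)]) ++ [-b])).IsChain (Edge T) := by
      have hB := h.headB
      cases LB with
      | nil => simp at hB
      | cons c LB =>
        obtain rfl : c = b := by simpa using hB
        have : ((c :: LB) ++ [-(a + c), -c]).IsChain (Edge T) := by
          rw [List.isChain_append]
          refine ⟨h.chainB, by simpa using (edgeT hr h2).neg, fun u hu v hv => ?_⟩
          rw [h.lastB] at hu
          obtain rfl : -a = u := by simpa using hu
          obtain rfl : -(a + c) = v := by simpa using hv
          exact (edgeT hl h1).neg
        simpa [edgeT hl h1, edgeT hr h2] using this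
    have hR := isChain_not_under hST.subT hST.closedT (k := k) hρ hρT hch
    rw [List.isChain_append] at hR
    have hB := h.headB
    have hlast := h.lastB
    cases LB with
    | nil => simp at hB
    | cons c LB =>
      obtain rfl : c = b := by simpa using hB
      have h3 := hR.2.2 (-a) (by simpa [List.getLast?_cons_cons] using hlast) (-(a + c)) (by simp)
      rw [List.isChain_cons_cons] at hR
      refine ⟨fun hu => h3 hu.neg, hR.1.1, fun hr => ⟨by simpa using hr, hR.1.2⟩⟩

lemma sy_sep_symm (p q : ℤ × ℤ) (x : V) : B (sy q (-p)) x = -B (sy p q) x := by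
  rw [sy_neg_right, B_neg_left, sy_comm]

/-- The root `ρ` is below no edge of the path `L` with coordinate sum at most `k`. -/
def Free (k : ℕ) (ρ : V) (L : List (ℤ × ℤ)) : Prop := L.IsChain fun u v => ¬ Under k ρ u v

lemma FareyArcs.improve {S T : Set V} {S' T' : Finset V} (hST : CrossNeg S T S' T')
    {p q : ℤ × ℤ} {LA LB : List (ℤ × ℤ)} (h : FareyArcs S T p q LA LB) {m : V → ℕ}
    (hm : ∀ τ ∈ S' ∪ T', ¬ (Free (m τ) τ LA ∧ Free (m τ) τ LB))
    {ρ : V} (hρ : ρ ∈ T') (hρA : ¬ Free (m ρ) ρ LA) :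
    ∃ (p' q' : ℤ × ℤ) (LA' LB' : List (ℤ × ℤ)) (m' : V → ℕ), FareyArcs S T p' q' LA' LB' ∧
      (∀ τ ∈ S' ∪ T', ¬ (Free (m' τ) τ LA' ∧ Free (m' τ) τ LB')) ∧
      ∑ τ ∈ S' ∪ T', m' τ < ∑ τ ∈ S' ∪ T', m τ := by
  obtain ⟨X, a, b, Y, hL, hu⟩ := exists_of_not_isChain hρA
  rw [not_not] at hu
  have hab : Edge S a b := by
    have := h.chainA
    rw [hL, List.isChain_append_cons_cons] at this
    exact this.2.1
  have hne : ∀ τ ∈ S' ∪ T', τ ≠ sy a b := by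
    rintro τ hτ rfl
    rcases Finset.mem_union.1 hτ with hτ | hτ
    · have := hu.B_pos hab.1 (B_self_of_mem (hST.subT (hST.memT _ hρ)).1)
      linarith [hST.neg _ hτ _ hρ]
    · exact hST.disj _ hab.2 (hST.memT _ hτ)
  have hpos : ∀ τ ∈ S' ∪ T', τ ∈ Φpos := fun τ hτ =>
    (Finset.mem_union.1 hτ).elim (fun h => hST.subS (hST.memS _ h))
      fun h => hST.subT (hST.memT _ h)
  have hsplit : ∀ τ ∈ S' ∪ T', ¬ Subdivides a b LA LB fun u v => ¬ Under (m τ) τ u v := by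
    intro τ hτ hs
    refine hm τ hτ (hs.2.2 fun hab' => ?_)
    obtain ⟨k, hk, h' | h'⟩ := hab'.split hab.1 (B_self_of_mem (hpos τ hτ).1) (hne τ hτ)
    · exact hs.1 (h'.mono hk.le)
    · exact hs.2.1 (h'.mono hk.le)
  rcases h.subdivide hST hL with ⟨p', q', LA', LB', hP, hsub⟩ | hT
  · have hρ' : ρ ∈ S' ∪ T' := Finset.mem_union_right _ hρ
    obtain ⟨k, hk, hku⟩ := hu.split hab.1 (B_self_of_mem (hpos ρ hρ').1) (hne ρ hρ')
    have hsub' : ∀ k τ, Free k τ LA' → Free k τ LB' →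
        Subdivides a b LA LB fun u v => ¬ Under k τ u v := fun k τ =>
      hsub _ fun u v h1 h2 => h1 h2.neg
    refine ⟨p', q', LA', LB', Function.update m ρ k, hP, fun τ hτ hcon => ?_, ?_⟩
    · by_cases hτρ : τ = ρ
      · subst hτρ
        rw [Function.update_self] at hcon
        have := hsub' k τ hcon.1 hcon.2
        exact hku.elim this.1 this.2.1
      · rw [Function.update_of_ne hτρ] at hcon
        exact hsplit τ hτ (hsub' _ _ hcon.1 hcon.2)
    · refine Finset.sum_lt_sum (fun τ _ => ?_) ⟨ρ, hρ', by rwa [Function.update_self]⟩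
      by_cases hτρ : τ = ρ
      · subst hτρ; rw [Function.update_self]; exact hk.le
      · rw [Function.update_of_ne hτρ]
  · obtain ⟨β, hβ⟩ := hST.nonemptyS
    have hβ' := Finset.mem_union_left T' hβ
    exact absurd (hT (m β) β (hpos β hβ') (hST.disj β (hST.memS β hβ))) (hsplit β hβ')

lemma FareyArcs.B_pos_of_not_free {S T : Set V} {p q : ℤ × ℤ} {LA LB : List (ℤ × ℤ)}
    (h : FareyArcs S T p q LA LB) {k : ℕ} {τ : V} (hτ : τ ∈ Φpos) (hf : ¬ Free k τ LA) :
    0 < B (sy p q) τ := by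
  obtain ⟨X, a, b, Y, hL, hu⟩ := exists_of_not_isChain hf
  rw [not_not] at hu
  have hc := h.chainA
  rw [hL, List.isChain_append_cons_cons] at hc
  exact h.B_pos (by simp [hL]) (by simp [hL]) hc.2.1.1 (B_self_of_mem hτ.1) hu

lemma FareyArcs.exists_separating {S T : Set V} {S' T' : Finset V} (hST : CrossNeg S T S' T')
    {p q : ℤ × ℤ} {LA LB : List (ℤ × ℤ)} (h : FareyArcs S T p q LA LB) {m : V → ℕ}
    (hm : ∀ τ ∈ S' ∪ T', ¬ (Free (m τ) τ LA ∧ Free (m τ) τ LB)) :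
    ∃ z, (∀ x ∈ S', 0 < B z x) ∧ ∀ x ∈ T', B z x < 0 := by
  obtain ⟨M, hM⟩ : ∃ M, ∑ τ ∈ S' ∪ T', m τ = M := ⟨_, rfl⟩
  induction M using Nat.strong_induction_on generalizing S T S' T' p q LA LB m with
  | _ M ih =>
    by_cases hA : ∃ ρ ∈ T', ¬ Free (m ρ) ρ LA
    · obtain ⟨ρ, hρ, hρA⟩ := hA
      obtain ⟨p', q', LA', LB', m', h', hm', hlt⟩ := h.improve hST hm hρ hρA
      exact ih _ (hM ▸ hlt) hST h' hm' rfl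
    by_cases hB : ∃ ρ ∈ S', ¬ Free (m ρ) ρ LB
    · obtain ⟨ρ, hρ, hρB⟩ := hB
      have hfree : ∀ k τ, Free k τ (LA.map fun u => -u) → Free k τ LA := by
        intro k τ hf
        rw [Free, List.isChain_map] at hf
        exact hf.imp fun u v h1 h2 => h1 h2.neg
      obtain ⟨p', q', LA', LB', m', h', hm', hlt⟩ := h.symm.improve hST.symm (m := m)
        (fun τ hτ hcon => hm τ (Finset.union_comm S' T' ▸ hτ) ⟨hfree _ _ hcon.2, hcon.1⟩) hρ hρB
      obtain ⟨z, hz1, hz2⟩ := ih _ (by rw [← hM]; simpa only [Finset.union_comm T' S'] using hlt)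
        hST.symm h' hm' rfl
      exact ⟨-z, fun x hx => by rw [B_neg_left]; linarith [hz2 x hx],
        fun x hx => by rw [B_neg_left]; linarith [hz1 x hx]⟩
    push Not at hA hB
    refine ⟨sy p q, fun x hx => ?_, fun x hx => ?_⟩
    · exact h.B_pos_of_not_free (hST.subS (hST.memS x hx)) fun hf =>
        hm x (Finset.mem_union_left _ hx) ⟨hf, hB x hx⟩
    · have := h.symm.B_pos_of_not_free (k := m x) (hST.subT (hST.memT x hx)) fun hf =>
        hm x (Finset.mem_union_right _ hx) ⟨hA x hx, hf⟩
      rw [sy_sep_symm] at this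
      linarith

lemma exists_under_of_mem {ρ : V} (hρ : ρ ∈ Φpos) :
    ∃ k, Under k ρ (1, 0) (1, 1) ∨ Under k ρ (1, 1) (0, 1) ∨ Under k ρ (0, 1) (-1, 0) := by
  obtain ⟨⟨z, hz⟩, hq, ho⟩ := mem_Φpos_iff.1 hρ
  have hz0 : ∀ i, 0 ≤ z i := fun i => by
    have := ho i
    rw [hz] at this
    exact_mod_cast this
  choose n hn using fun i => Int.eq_ofNat_of_zero_le (hz0 i)
  have hρn : ∀ i, ρ i = n i := fun i => by rw [hz, hn]; simp
  obtain ⟨i, hi⟩ := exists_B_α_pos ho (hq ▸ one_pos)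
  rw [B_α', hρn, hρn, hρn] at hi
  have hle : n (i + 1) + n (i + 2) ≤ n i := by
    have : (n (i + 1) + n (i + 2) : ℝ) ≤ n i := by linarith
    exact_mod_cast this
  have key : ∀ x y z : ℕ, ∀ a b : ℤ × ℤ,
      (∀ j, ρ j = ((x : ℝ) • sy a b + (y : ℝ) • sy a a + (z : ℝ) • sy b b) j) →
      Under (x + y + z) ρ a b := fun x y z a b h => ⟨x, y, z, le_rfl, funext h⟩
  fin_cases i
  · refine ⟨_, Or.inr (Or.inl (key (n 0 - n 1 - n 2) (n 1) (n 2) _ _ ?_))⟩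
    have h1 : n 1 + n 2 ≤ n 0 := hle
    have h2 : n 1 ≤ n 0 := by omega
    have h3 : n 2 ≤ n 0 - n 1 := by omega
    intro j; rw [hρn]; push_cast [h2, h3]
    fin_cases j <;> simp [sy]; ring
  · refine ⟨_, Or.inl (key (n 1 - n 2 - n 0) (n 2) (n 0) _ _ ?_)⟩
    have h1 : n 2 + n 0 ≤ n 1 := hle
    have h2 : n 2 ≤ n 1 := by omega
    have h3 : n 0 ≤ n 1 - n 2 := by omega
    intro j; rw [hρn]; push_cast [h2, h3]
    fin_cases j <;> simp [sy]; ring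
  · refine ⟨_, Or.inr (Or.inr (key (n 2 - n 0 - n 1) (n 0) (n 1) _ _ ?_))⟩
    have h1 : n 0 + n 1 ≤ n 2 := hle
    have h2 : n 0 ≤ n 2 := by omega
    have h3 : n 1 ≤ n 2 - n 0 := by omega
    intro j; rw [hρn]; push_cast [h2, h3]
    fin_cases j <;> simp [sy]; ring

lemma α_mem (i : Fin 3) : α i ∈ Φpos :=
  mem_Φpos_iff.2 ⟨intVec_α i, B_α_self i, fun l => by rw [α_apply]; split_ifs <;> simp⟩

lemma mem_of_simple_mem {S : Set V} (hc : IsClosedSet S) (h : ∀ i, α i ∈ S) {γ : V}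
    (hγ : γ ∈ Φpos) : γ ∈ S := by
  revert hγ
  by_cases hγ : γ ∈ Φpos
  swap
  · exact fun h => absurd h hγ
  refine ht_induction (p := fun γ => γ ∈ Φpos → γ ∈ S) (fun γ _ _ ih hγ => ?_)
    (mem_Φpos_iff.1 hγ).1 (oct_of_mem hγ)
  by_cases hs : ∃ i, γ = α i
  · obtain ⟨i, rfl⟩ := hs
    exact h i
  push Not at hs
  obtain ⟨δ, hδ, ε, hε, s, t, hs, ht', e, -⟩ := exists_tangent hγ hs
  obtain ⟨h1, h2⟩ := ht_lt_of_tangent hδ hε hs ht' e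
  exact hc δ (ih δ (mem_Φpos_iff.1 hδ).1 (oct_of_mem hδ) h1 hδ)
    ε (ih ε (mem_Φpos_iff.1 hε).1 (oct_of_mem hε) h2 hε)
    ⟨mem_nnspan_pair.2 ⟨s, t, by linarith, by linarith, e⟩, hγ⟩

lemma sy_basic : sy (1, 0) (1, 1) = α 1 ∧ sy (1, 1) (0, 1) = α 0 ∧ sy (0, 1) (-1, 0) = α 2 := by
  refine ⟨?_, ?_, ?_⟩ <;> funext j <;> fin_cases j <;> simp [sy, α]

lemma exists_separating_of_triangle {S T : Set V} {S' T' : Finset V} (hST : CrossNeg S T S' T')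
    {a b c : ℤ × ℤ} (hab : Edge S a b) (hbc : Edge T b c) (hca : Edge T c (-a))
    (hac : 0 ≤ det2 a c)
    (hcov : ∀ ρ ∈ Φpos, ∃ k, Under k ρ a b ∨ Under k ρ b c ∨ Under k ρ c (-a)) :
    ∃ z, (∀ x ∈ S', 0 < B z x) ∧ ∀ x ∈ T', B z x < 0 := by
  have hP : FareyArcs S T a b [a, b] [b, c, -a] :=
    { headA := rfl, lastA := rfl, headB := rfl, lastB := rfl
      chainA := by simpa using hab
      chainB := by simpa using ⟨hbc, hca⟩
      pairwise := by
        simp [det2_neg_right, det2_self, hab.1, hbc.1, hac, ← det2_swap]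
      pos := by rw [hab.1]; exact one_pos }
  choose! m hm using hcov
  refine hP.exists_separating hST (m := m) fun τ hτ hf => ?_
  have := hm τ ((Finset.mem_union.1 hτ).elim (fun h => hST.subS (hST.memS _ h))
      fun h => hST.subT (hST.memT _ h))
  simp only [Free, List.isChain_cons_cons] at hf
  tauto

lemma CrossNeg.exists_separating' {S T : Set V} {S' T' : Finset V} (hST : CrossNeg S T S' T')
    (i : Fin 3) (hi : α i ∈ S) (h1 : α (i + 1) ∈ T) (h2 : α (i + 2) ∈ T) :
    ∃ z, (∀ x ∈ S', 0 < B z x) ∧ ∀ x ∈ T', B z x < 0 := by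
  obtain ⟨e1, e2, e3⟩ := sy_basic
  have n1 : sy (-1, 0) (-(1, 1)) = α 1 := by rw [← e1, ← sy_neg_neg]; simp
  have n2 : sy (-(1, 1)) (-(0, 1)) = α 0 := by rw [← e2, sy_neg_neg]
  fin_cases i
  · refine exists_separating_of_triangle hST (a := (1, 1)) (b := (0, 1)) (c := (-1, 0))
      ⟨rfl, e2 ▸ hi⟩ ⟨rfl, e3 ▸ h2⟩ ⟨rfl, n1 ▸ h1⟩ (by decide) fun ρ hρ => ?_
    obtain ⟨k, h | h | h⟩ := exists_under_of_mem hρ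
    exacts [⟨k, Or.inr (Or.inr h.neg)⟩, ⟨k, Or.inl h⟩, ⟨k, Or.inr (Or.inl h)⟩]
  · refine exists_separating_of_triangle hST (a := (1, 0)) (b := (1, 1)) (c := (0, 1))
      ⟨rfl, e1 ▸ hi⟩ ⟨rfl, e2 ▸ h2⟩ ⟨rfl, e3 ▸ h1⟩ (by decide) fun ρ hρ => exists_under_of_mem hρ
  · refine exists_separating_of_triangle hST (a := (0, 1)) (b := (-1, 0)) (c := -(1, 1))
      ⟨rfl, e3 ▸ hi⟩ ⟨rfl, n1 ▸ h2⟩ ⟨rfl, n2 ▸ h1⟩ (by decide) fun ρ hρ => ?_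
    obtain ⟨k, h | h | h⟩ := exists_under_of_mem hρ
    exacts [⟨k, Or.inr (Or.inl h.neg)⟩, ⟨k, Or.inr (Or.inr h.neg)⟩, ⟨k, Or.inl h⟩]

/-- Finite subsets of complementary closed sets that pair negatively are linearly separated. -/
lemma CrossNeg.exists_separating {S T : Set V} {S' T' : Finset V} (hST : CrossNeg S T S' T') :
    ∃ z, (∀ x ∈ S', 0 < B z x) ∧ ∀ x ∈ T', B z x < 0 := by
  have flip : (∃ z, (∀ x ∈ T', 0 < B z x) ∧ ∀ x ∈ S', B z x < 0) →
      ∃ z, (∀ x ∈ S', 0 < B z x) ∧ ∀ x ∈ T', B z x < 0 := by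
    rintro ⟨z, hz1, hz2⟩
    exact ⟨-z, fun x hx => by rw [B_neg_left]; linarith [hz2 x hx],
        fun x hx => by rw [B_neg_left]; linarith [hz1 x hx]⟩
  have notall : ∀ {S T : Set V} {S' T' : Finset V}, CrossNeg S T S' T' →
      α 0 ∈ S → α 1 ∈ S → α 2 ∈ S → False := by
    intro S T S' T' hST h0 h1 h2
    obtain ⟨x, hx⟩ := hST.nonemptyT
    have hxT := hST.memT x hx
    refine hST.disj x (mem_of_simple_mem hST.closedS (fun i => ?_) (hST.subT hxT)) hxT
    fin_cases i <;> assumption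
  rcases hST.cover _ (α_mem 0) with h0 | h0 <;> rcases hST.cover _ (α_mem 1) with h1 | h1 <;>
    rcases hST.cover _ (α_mem 2) with h2 | h2
  · exact (notall hST h0 h1 h2).elim
  · exact flip (hST.symm.exists_separating' 2 h2 h0 h1)
  · exact flip (hST.symm.exists_separating' 1 h1 h2 h0)
  · exact hST.exists_separating' 0 h0 h1 h2
  · exact flip (hST.symm.exists_separating' 0 h0 h1 h2)
  · exact hST.exists_separating' 1 h1 h2 h0
  · exact hST.exists_separating' 2 h2 h0 h1
  · exact (notall hST.symm h0 h1 h2).elim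

/-! ### Half-spaces of roots attached to biclosed sets -/

lemma IsBiclosed.compl {R : Set V} (hR : IsBiclosed R) : IsBiclosed (Φpos \ R) := by
  refine ⟨Set.sdiff_subset, hR.2.2, ?_⟩
  rw [Set.sdiff_sdiff_cancel_left hR.1]
  exact hR.2.1

lemma IsClosedSet.mem {C : Set V} (hC : IsClosedSet C) {x y z : V} {s t : ℝ} (hx : x ∈ C)
    (hy : y ∈ C) (hz : z ∈ Φpos) (hs : 0 ≤ s) (ht : 0 ≤ t) (h : z = s • x + t • y) : z ∈ C :=
  hC x hx y hy ⟨mem_nnspan_pair.2 ⟨s, t, hs, ht, h⟩, hz⟩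

/-- The roots which are elements of `R` or negatives of positive roots
outside `R`. -/
def halfSpace (R : Set V) : Set V := {x | x ∈ R ∨ -x ∈ Φpos \ R}

lemma mem_halfSpace_or {R : Set V} {x : V} (hx : x ∈ Φ) :
    x ∈ halfSpace R ∨ -x ∈ halfSpace R := by
  simp only [halfSpace, Set.mem_ofPred_eq, neg_neg, Set.mem_sdiff]
  rcases mem_Φ_or hx with h | h <;> tauto

lemma IsBiclosed.halfSpace_subset {R : Set V} (hR : IsBiclosed R) {x : V} (hx : x ∈ halfSpace R) :
    x ∈ Φ := by
  rcases hx with h | h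
  · exact (hR.1 h).1
  · exact neg_neg x ▸ neg_mem_Φ h.1.1

lemma IsBiclosed.mem_of_two {R : Set V} (hR : IsBiclosed R) {x y z : V} {a b c : ℝ} (hx : x ∈ R)
    (hy : y ∈ R) (hz : z ∈ Φpos) (ha : 0 ≤ a) (hb : 0 ≤ b) (hc : 0 ≤ c) (h0 : 0 < a + b + c)
    (h : a • x + b • y = c • z) : z ∈ R := by
  rcases hc.eq_or_lt with rfl | hc
  · have := congrArg ht h
    have h1 := one_le_ht (hR.1 hx)
    have h2 := one_le_ht (hR.1 hy)
    rw [ht_add, ht_smul, ht_smul, ht_smul] at this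
    nlinarith
  · refine hR.2.1.mem hx hy hz (s := a / c) (t := b / c) (by positivity) (by positivity) ?_
    have : z = c⁻¹ • (c • z) := by rw [smul_smul, inv_mul_cancel₀ hc.ne', one_smul]
    rw [this, ← h]
    module

lemma IsBiclosed.no_relation_three {R : Set V} (hR : IsBiclosed R) {x y z : V} {a b c : ℝ}
    (hx : x ∈ halfSpace R) (hy : y ∈ halfSpace R) (hz : z ∈ halfSpace R) (ha : 0 ≤ a) (hb : 0 ≤ b)
    (hc : 0 ≤ c) (h0 : 0 < a + b + c) (h : a • x + b • y + c • z = 0) : False := by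
  have pos : ∀ {x y z : V}, x ∈ Φpos → y ∈ Φpos → z ∈ Φpos → a • x + b • y + c • z ≠ 0 := by
    intro x y z hx hy hz h
    have := congrArg ht h
    have h1 := one_le_ht hx
    have h2 := one_le_ht hy
    have h3 := one_le_ht hz
    simp only [ht_add, ht_smul, show ht 0 = 0 by simp [ht]] at this
    nlinarith
  have e1 : a • x + b • y = c • -z := by linear_combination (norm := module) h
  have e2 : a • x + c • z = b • -y := by linear_combination (norm := module) h
  have e3 : b • y + c • z = a • -x := by linear_combination (norm := module) h
  have f1 : a • -x + b • -y = c • z := by linear_combination (norm := module) -e1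
  have f2 : a • -x + c • -z = b • y := by linear_combination (norm := module) -e2
  have f3 : b • -y + c • -z = a • x := by linear_combination (norm := module) -e3
  have h1 : 0 < a + c + b := by linarith
  have h2 : 0 < b + c + a := by linarith
  rcases hx with hx | hx <;> rcases hy with hy | hy <;> rcases hz with hz | hz
  · exact pos (hR.1 hx) (hR.1 hy) (hR.1 hz) h
  · exact hz.2 (hR.mem_of_two hx hy hz.1 ha hb hc h0 e1)
  · exact hy.2 (hR.mem_of_two hx hz hy.1 ha hc hb h1 e2)
  · exact (hR.compl.mem_of_two hy hz (hR.1 hx) hb hc ha h2 f3).2 hx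
  · exact hx.2 (hR.mem_of_two hy hz hx.1 hb hc ha h2 e3)
  · exact (hR.compl.mem_of_two hx hz (hR.1 hy) ha hc hb h1 f2).2 hy
  · exact (hR.compl.mem_of_two hx hy (hR.1 hz) ha hb hc h0 f1).2 hz
  · exact pos hx.1 hy.1 hz.1 (by linear_combination (norm := module) -h)

lemma IsBiclosed.halfSpace_mem {R : Set V} (hR : IsBiclosed R) {x y z : V} {a b : ℝ}
    (hx : x ∈ halfSpace R) (hy : y ∈ halfSpace R) (hz : z ∈ Φ) (ha : 0 ≤ a) (hb : 0 ≤ b)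
    (h : z = a • x + b • y) : z ∈ halfSpace R :=
  (mem_halfSpace_or hz).resolve_right fun h' => hR.no_relation_three hx hy h' ha hb zero_le_one
    (by linarith) (by rw [h]; module)

lemma IsBiclosed.no_relation_of_zero {R : Set V} (hR : IsBiclosed R) {v : Fin 4 → V}
    (hv : ∀ i, v i ∈ halfSpace R) {a : Fin 4 → ℝ} (ha : ∀ i, 0 ≤ a i) {i j : Fin 4} (hi : a i = 0)
    (hj : 0 < a j) (h : ∑ i, a i • v i = 0) : False := by
  rw [Fin.sum_univ_succAbove _ i, hi, zero_smul, zero_add, Fin.sum_univ_three] at h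
  refine hR.no_relation_three (hv _) (hv _) (hv _) (ha _) (ha _) (ha _) ?_ h
  have hne : i ≠ j := by rintro rfl; exact hj.ne' hi
  obtain ⟨l, rfl⟩ := Fin.exists_succAbove_eq hne.symm
  have h0 := ha (i.succAbove 0)
  have h1 := ha (i.succAbove 1)
  have h2 := ha (i.succAbove 2)
  fin_cases l <;> simp at hj <;> linarith

lemma exists_shift {ι : Type*} [Fintype ι] {a t : ι → ℝ} (ha : ∀ i, 0 ≤ a i) {i : ι}
    (hi : 0 < t i) : ∃ u : ℝ, 0 ≤ u ∧ (∀ j, 0 ≤ a j - u * t j) ∧ ∃ l, 0 < t l ∧ u = a l / t l := by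
  obtain ⟨l, hl, hmin⟩ := Finset.exists_min_image (Finset.univ.filter fun i => 0 < t i)
    (fun i => a i / t i) ⟨i, by simpa using hi⟩
  simp only [Finset.mem_filter, Finset.mem_univ, true_and] at hl hmin
  have hu : 0 ≤ a l / t l := div_nonneg (ha l) hl.le
  refine ⟨_, hu, fun m => ?_, l, hl, rfl⟩
  rcases lt_or_ge 0 (t m) with hm | hm
  · have := hmin m hm
    rw [le_div_iff₀ hm] at this
    linarith
  · nlinarith [ha m]

/-- A strictly positive relation with another relation that is not strictly of one sign can be
shifted to a nonnegative relation in three roots, which is impossible. -/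
lemma IsBiclosed.no_relation_shift {R : Set V} (hR : IsBiclosed R) {v : Fin 4 → V}
    (hv : ∀ i, v i ∈ halfSpace R) {a t : Fin 4 → ℝ} (ha : ∀ i, 0 < a i)
    (h : ∑ i, a i • v i = 0) (h' : ∑ i, t i • v i = 0) {i j : Fin 4} (hi : 0 < t i) (hj : t j ≤ 0) :
    False := by
  obtain ⟨u, hu, hnn, l, hl, hul⟩ := exists_shift (fun i => (ha i).le) hi
  refine hR.no_relation_of_zero hv hnn (i := l) (j := j) (by rw [hul]; field_simp; ring)
    (by nlinarith [ha j]) ?_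
  simp only [sub_smul, mul_smul, Finset.sum_sub_distrib, ← Finset.smul_sum, h, h', smul_zero,
    sub_zero]

lemma exists_int_relation {v : Fin 4 → V} (hv : ∀ i, IntVec (v i)) :
    ∃ t : Fin 4 → ℤ, t ≠ 0 ∧ ∑ i, (t i : ℝ) • v i = 0 := by
  choose z hz using hv
  obtain ⟨t, ht, h⟩ := Matrix.exists_mulVec_eq_zero_iff.2
    (Matrix.det_eq_zero_of_row_eq_zero (A := Matrix.of fun (i j : Fin 4) =>
      (Fin.snoc (z j) 0 : Fin 4 → ℤ) i) (Fin.last 3) fun j =>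
      Fin.snoc_last (α := fun _ => ℤ) 0 (z j))
  refine ⟨t, ht, funext fun k => ?_⟩
  have := congrFun h k.castSucc
  simp only [Matrix.mulVec, dotProduct, Matrix.of_apply, Fin.snoc_castSucc, Pi.zero_apply] at this
  simp only [Finset.sum_apply, Pi.smul_apply, smul_eq_mul, hz, Pi.zero_apply]
  rw [← Int.cast_zero, ← this]
  push_cast
  exact Finset.sum_congr rfl fun _ _ => mul_comm _ _

lemma exists_relation_of_B_eq_zero {x y z u : V} (hu : u ≠ 0) (hx : B u x = 0) (hy : B u y = 0)
    (hz : B u z = 0) : ∃ t : Fin 3 → ℝ, t ≠ 0 ∧ t 0 • x + t 1 • y + t 2 • z = 0 := by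
  have hdet : Matrix.det (![x, y, z] : Matrix (Fin 3) (Fin 3) ℝ) = 0 := by
    refine Matrix.exists_mulVec_eq_zero_iff.1 ⟨fun i => B (α i) u, fun h => hu ?_, ?_⟩
    · have h0 := congrFun h 0
      have h1 := congrFun h 1
      have h2 := congrFun h 2
      simp only [B_α, ht, Pi.zero_apply] at h0 h1 h2
      ext i
      fin_cases i <;> simp <;> linarith
    · ext i
      have hB : ∀ w : V, w ⬝ᵥ (fun i => B (α i) u) = B u w := fun w => by
        simp only [dotProduct, Fin.sum_univ_three, B_α, ht, B_eq u w]; ring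
      fin_cases i <;> simp [Matrix.mulVec, hB, hx, hy, hz]
  obtain ⟨t, ht, h⟩ := Matrix.exists_vecMul_eq_zero_iff.2 hdet
  refine ⟨t, ht, ?_⟩
  rw [← h]
  ext i
  simp [Matrix.vecMul, dotProduct, Fin.sum_univ_three]

lemma IsBiclosed.exists_shorter_aux {R : Set V} (hR : IsBiclosed R) {p q : V}
    (hp : p ∈ halfSpace R) (hq : q ∈ halfSpace R) {k : ℤ} (hk : 1 ≤ k) (e : ℕ) :
    ∀ (f : ℤ) (σ τ : V), σ ∈ halfSpace R → τ ∈ halfSpace R → B σ τ = k → (e : ℤ) < f →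
    (∃ x y : ℝ, 0 ≤ x ∧ 0 ≤ y ∧ τ = x • p + y • q) →
    (∃ x y : ℝ, 0 ≤ x ∧ 0 ≤ y ∧ τ - σ = x • p + y • q) →
    0 < f ^ 2 + (e : ℤ) ^ 2 - 2 * k * e * f →
    ∃ p' ∈ halfSpace R, ∃ q' ∈ halfSpace R, ∃ a b : ℤ, 0 ≤ a ∧ 0 ≤ b ∧ a + b ≤ f ∧
      (f : ℝ) • τ - (e : ℝ) • σ = (a : ℝ) • p' + (b : ℝ) • q' := by
  induction e using Nat.strong_induction_on with
  | _ e ih =>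
  rintro f σ τ hσ hτ hB hef ⟨x, y, hx, hy, hxy⟩ ⟨x', y', hx', hy', hxy'⟩ hQ
  have hσΦ := hR.halfSpace_subset hσ
  have hτΦ := hR.halfSpace_subset hτ
  have hk' : (1 : ℝ) ≤ k := by exact_mod_cast hk
  have hτ1 := (mem_Φ_iff.1 hτΦ).2
  have hρ : (2 * k : ℝ) • τ - σ ∈ halfSpace R := by
    refine hR.halfSpace_mem hp hq (a := (2 * k - 1) * x + x') (b := (2 * k - 1) * y + y') ?_
      (by nlinarith) (by nlinarith) ?_
    · have h := neg_mem_Φ (rootRefl_mem_Φ hτΦ hσΦ)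
      rw [rootRefl, B_comm, hB, neg_sub] at h
      exact h
    · linear_combination (norm := module) (2 * k - 1 : ℝ) • hxy + hxy'
  have he0 : (0 : ℤ) ≤ e := Int.natCast_nonneg e
  rcases le_or_gt (2 * k * e) f with hf | hf
  · refine ⟨_, hρ, τ, hτ, e, f - 2 * k * e, he0, by linarith, by nlinarith, ?_⟩
    push_cast
    module
  · obtain ⟨e', he'⟩ := Int.eq_ofNat_of_zero_le (a := 2 * k * e - f) (by linarith)
    have hlt : (e' : ℤ) < e := by
      rw [← he']
      by_contra! hcon
      nlinarith
    obtain ⟨p', hp', q', hq', a, b, ha, hb, hab, h⟩ := ih e' (by exact_mod_cast hlt) e τ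
      ((2 * k : ℝ) • τ - σ) hτ hρ
      (by rw [B_sub_right, B_smul_right, hτ1, B_comm, hB]; ring) hlt
      ⟨(2 * k - 1) * x + x', (2 * k - 1) * y + y', by nlinarith, by nlinarith,
        by linear_combination (norm := module) (2 * k - 1 : ℝ) • hxy + hxy'⟩
      ⟨(2 * k - 2) * x + x', (2 * k - 2) * y + y', by nlinarith, by nlinarith,
        by linear_combination (norm := module) (2 * k - 2 : ℝ) • hxy + hxy'⟩
      (by rw [← he']; nlinarith)
    refine ⟨p', hp', q', hq', a, b, ha, hb, by linarith, ?_⟩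
    rw [← h]
    have : (e' : ℝ) = 2 * k * e - f := by exact_mod_cast he'.symm
    rw [this, Int.cast_natCast]
    module

/-- A positive integral combination of two roots of a half-space which has positive norm can be
rewritten with smaller total coefficient. -/
lemma IsBiclosed.exists_shorter {R : Set V} (hR : IsBiclosed R) {p q : V}
    (hp : p ∈ halfSpace R) (hq : q ∈ halfSpace R) {k a b : ℤ} (hk : 1 ≤ k) (hB : B p q = -k)
    (ha : 0 < a) (hb : 0 < b) (hab : b ≤ a) (hQ : 0 < a ^ 2 + b ^ 2 - 2 * k * a * b) :
    ∃ p' ∈ halfSpace R, ∃ q' ∈ halfSpace R, ∃ a' b' : ℤ, 0 ≤ a' ∧ 0 ≤ b' ∧ a' + b' < a + b ∧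
      (a : ℝ) • p + (b : ℝ) • q = (a' : ℝ) • p' + (b' : ℝ) • q' := by
  have hpΦ := hR.halfSpace_subset hp
  have hp1 := (mem_Φ_iff.1 hpΦ).2
  have hk' : (1 : ℝ) ≤ k := by exact_mod_cast hk
  have hτ : (2 * k : ℝ) • p + q ∈ halfSpace R := by
    refine hR.halfSpace_mem hp hq (a := 2 * k) (b := 1) ?_ (by linarith) zero_le_one (by module)
    have h := rootRefl_mem_Φ hpΦ (hR.halfSpace_subset hq)
    rw [rootRefl, hB] at h
    convert h using 1
    module
  rcases le_or_gt (2 * k * b) a with h | h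
  · refine ⟨_, hτ, p, hp, b, a - 2 * k * b, hb.le, by linarith, by nlinarith, ?_⟩
    push_cast
    module
  · obtain ⟨e, he⟩ := Int.eq_ofNat_of_zero_le (a := 2 * k * b - a) (by linarith)
    obtain ⟨p', hp', q', hq', a', b', ha', hb', hab', h'⟩ := hR.exists_shorter_aux hp hq hk e b p
      ((2 * k : ℝ) • p + q) hp hτ (by rw [B_add_right, B_smul_right, hp1, hB]; ring)
      (by rw [← he]; by_contra! hcon; nlinarith) ⟨2 * k, 1, by linarith, zero_le_one, by module⟩
      ⟨2 * k - 1, 1, by linarith, zero_le_one, by module⟩ (by rw [← he]; nlinarith)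
    refine ⟨p', hp', q', hq', a', b', ha', hb', by linarith, ?_⟩
    rw [← h']
    have : (e : ℝ) = 2 * k * b - a := by exact_mod_cast he.symm
    rw [this]
    module

lemma eq_of_sq_add_sq {a b k : ℤ} (ha : 0 < a) (hb : 0 < b) (h : a ^ 2 + b ^ 2 = 2 * k * a * b) :
    a = b := by
  have key : ∀ a b : ℤ, a ^ 2 + b ^ 2 = 2 * k * a * b → b ∣ a := fun a b h => by
    have h1 : b ^ 2 ∣ (a - k * b) ^ 2 := ⟨k ^ 2 - 1, by linear_combination h⟩
    have h2 : b ∣ a - k * b := (Int.pow_dvd_pow_iff two_ne_zero).1 h1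
    exact (dvd_sub_left (Dvd.intro_left k rfl)).1 h2
  exact Int.dvd_antisymm ha.le hb.le (key b a (by linarith)) (key a b h)

lemma B_self_pos_of_orthogonal {w x : V} (hw : B w w < 0) (h : B w x = 0) (hx : x ≠ 0) :
    0 < B x x := by
  have hpos : 0 < x 0 ^ 2 + x 1 ^ 2 + x 2 ^ 2 := by
    by_contra! hcon
    have h0 := sq_nonneg (x 0)
    have h1 := sq_nonneg (x 1)
    have h2 := sq_nonneg (x 2)
    refine hx (funext fun i => ?_)
    have : x i ^ 2 = 0 := by
      fin_cases i <;> simp only [Fin.zero_eta, Fin.mk_one, Fin.reduceFinMk] <;> linarith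
    simpa using this
  rw [B_eq] at *
  obtain ⟨d, hd⟩ : ∃ d, d = w 0 * x 0 + w 1 * x 1 + w 2 * x 2 := ⟨_, rfl⟩
  obtain ⟨n, hn⟩ : ∃ n, n = w 0 ^ 2 + w 1 ^ 2 + w 2 ^ 2 := ⟨_, rfl⟩
  obtain ⟨m, hm⟩ : ∃ m, m = x 0 ^ 2 + x 1 ^ 2 + x 2 ^ 2 := ⟨_, rfl⟩
  obtain ⟨a, ha⟩ : ∃ a, a = w 0 + w 1 + w 2 := ⟨_, rfl⟩
  obtain ⟨b, hb⟩ : ∃ b, b = x 0 + x 1 + x 2 := ⟨_, rfl⟩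
  have hcs : d ^ 2 ≤ n * m := by
    rw [hd, hn, hm]
    nlinarith [sq_nonneg (w 0 * x 1 - w 1 * x 0), sq_nonneg (w 0 * x 2 - w 2 * x 0),
      sq_nonneg (w 1 * x 2 - w 2 * x 1)]
  have h1 : 2 * n < a ^ 2 := by rw [hn, ha]; linarith
  have h2 : 2 * d = a * b := by rw [hd, ha, hb]; linarith
  rw [← hm] at hpos
  suffices b ^ 2 < 2 * m by rw [hm, hb] at this; linarith
  have h3 : (a * b) ^ 2 < a ^ 2 * (2 * m) := by
    rw [← h2]; nlinarith
  have ha2 : 0 < a ^ 2 := by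
    have : 0 ≤ n := by rw [hn]; positivity
    linarith
  rw [mul_pow] at h3
  exact lt_of_mul_lt_mul_left h3 ha2.le

/-- Reflecting pushes a root of a half-space far away while keeping `w` in the cone. -/
lemma IsBiclosed.exists_far {R : Set V} (hR : IsBiclosed R) {p q w : V}
    (hp : p ∈ halfSpace R) (hq : q ∈ halfSpace R) {a b : ℝ} (ha : 0 < a) (hb : 0 < b)
    (hw : w = a • p + b • q) (hi : IntVec w) (hQ : B w w < 0) (n : ℕ) :
    ∃ p' ∈ halfSpace R, ∃ a' b' x y : ℝ, 0 < a' ∧ 0 < b' ∧ w = a' • p' + b' • q ∧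
      p' = x • p + y • w ∧ B p' w ≤ B p w - n := by
  induction n with
  | zero => exact ⟨p, hp, a, b, 1, 0, ha, hb, hw, by module, by simp⟩
  | succ n ih =>
    obtain ⟨p', hp', a', b', x, y, ha', hb', hw', hx, hn⟩ := ih
    have hpΦ := hR.halfSpace_subset hp'
    have hqΦ := hR.halfSpace_subset hq
    have hp1 := (mem_Φ_iff.1 hpΦ).2
    have hq1 := (mem_Φ_iff.1 hqΦ).2
    obtain ⟨k, hk⟩ : ∃ k, k = -B p' q := ⟨_, rfl⟩
    have hBk : B p' q = -k := by linarith
    have hQ' : a' ^ 2 + b' ^ 2 < 2 * k * a' * b' := by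
      rw [hw'] at hQ
      simp only [B_add_left, B_add_right, B_smul_left, B_smul_right, hp1, hq1, B_comm q p', hBk]
        at hQ
      nlinarith
    have hab : 0 < a' * b' := by positivity
    have hk1 : 1 < k := by nlinarith [sq_nonneg (a' - b')]
    have hlt : a' < 2 * k * b' := by nlinarith
    have hσΦ : (2 * k) • p' + q ∈ Φ := by
      have h := rootRefl_mem_Φ hpΦ hqΦ
      rw [rootRefl, hBk] at h
      convert h using 1
      module
    have hσ : (2 * k) • p' + q ∈ halfSpace R :=
      hR.halfSpace_mem hp' hq hσΦ (a := 2 * k) (b := 1) (by linarith) zero_le_one (by module)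
    have hdiff : B ((2 * k) • p' + q) w - B p' w = (k - 1) * (a' - (2 * k + 1) * b') := by
      rw [hw']
      simp only [B_add_left, B_add_right, B_smul_left, B_smul_right, hp1, hq1, B_comm q p', hBk]
      ring
    have hneg : B ((2 * k) • p' + q) w < B p' w := by nlinarith
    refine ⟨_, hσ, a' / (2 * k), b' - a' / (2 * k), (2 * k - a' / b') * x,
      (2 * k - a' / b') * y + 1 / b', by positivity, ?_, ?_, ?_, ?_⟩
    · rw [sub_pos, div_lt_iff₀ (by linarith)]
      linarith
    · have : a' / (2 * k) * (2 * k) = a' := by field_simp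
      rw [hw']
      linear_combination (norm := module) -this • p'
    · have h1 : 1 / b' * a' = a' / b' := by field_simp
      have h2 : 1 / b' * b' = 1 := by field_simp
      linear_combination (norm := module)
        (2 * k - a' / b') • hx - (1 / b') • hw' - h1 • p' - h2 • q
    · obtain ⟨m, hm⟩ := (mem_Φ_iff.1 hσΦ).1.B hi
      obtain ⟨m', hm'⟩ := (mem_Φ_iff.1 hpΦ).1.B hi
      rw [hm, hm'] at hneg
      rw [hm'] at hn
      rw [hm]
      have : m + 1 ≤ m' := by exact_mod_cast hneg
      have : (m : ℝ) + 1 ≤ m' := by exact_mod_cast this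
      push_cast
      linarith

lemma IsBiclosed.exists_far_pair {R : Set V} (hR : IsBiclosed R) {p q w : V}
    (hp : p ∈ halfSpace R) (hq : q ∈ halfSpace R) {a b : ℝ} (ha : 0 < a) (hb : 0 < b)
    (hw : w = a • p + b • q) (hi : IntVec w) (hQ : B w w < 0) (T : ℝ) :
    ∃ p' ∈ halfSpace R, ∃ q' ∈ halfSpace R, ∃ a' b' : ℝ, 0 < a' ∧ 0 < b' ∧ w = a' • p' + b' • q' ∧
      (∃ x y : ℝ, p' = x • p + y • w) ∧ (∃ x y : ℝ, q' = x • p + y • w) ∧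
      B p' w ≤ -T ∧ B q' w ≤ -T := by
  obtain ⟨n, hn⟩ := exists_nat_ge (B p w + T)
  obtain ⟨m, hm⟩ := exists_nat_ge (B q w + T)
  obtain ⟨p', hp', a₁, b₁, x, y, ha₁, hb₁, hw₁, hx, hpn⟩ := hR.exists_far hp hq ha hb hw hi hQ n
  obtain ⟨q', hq', b₂, a₂, x', y', hb₂, ha₂, hw₂, hx', hqm⟩ :=
    hR.exists_far hq hp' hb₁ ha₁ (hw₁.trans (add_comm _ _)) hi hQ m
  refine ⟨p', hp', q', hq', a₂, b₂, ha₂, hb₂, hw₂.trans (add_comm _ _), ⟨x, y, hx⟩,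
    ⟨-(x' / b * a), y' + x' / b, ?_⟩, by linarith, by linarith⟩
  have h : x' / b * b = x' := by field_simp
  linear_combination (norm := module) hx' - (x' / b) • hw - h • q

lemma B_sq_lt_of_orthogonal {w x y : V} (hw : B w w < 0) (hx : B w x = 0) (hy : B w y = 0)
    (hpos : 0 < B x x) (h : B x x • y - B x y • x ≠ 0) : B x y ^ 2 < B x x * B y y := by
  have := B_self_pos_of_orthogonal hw (by simp [B_sub_right, B_smul_right, hx, hy]) h
  simp only [B_sub_left, B_sub_right, B_smul_left, B_smul_right, B_comm y x] at this
  have h' : 0 < B x x * (B x x * B y y - B x y ^ 2) := by linarith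
  linarith [(mul_pos_iff_of_pos_left hpos).1 h']

lemma B_pos_of_far {w p r p' r' g h : V} {c x y x' y' T : ℝ} (hw : B w w = -c) (hc : 0 < c)
    (hg : g = c • p + B p w • w) (hh : h = c • r + B r w • w)
    (hp' : p' = x • p + y • w) (hr' : r' = x' • r + y' • w) (hp1 : B p' p' = 1) (hr1 : B r' r' = 1)
    (hT0 : 0 < T) (hTc : c ≤ T ^ 2)
    (hT : 3 * c * B g h ^ 2 < T ^ 2 * (B g g * B h h - B g h ^ 2))
    (hX : B p' w ≤ -T) (hY : T ≤ B r' w) : 0 < B p' r' := by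
  have eg : x • g = c • p' + B p' w • w := by
    rw [hg, hp', B_add_left, B_smul_left, B_smul_left, hw]; module
  have eh : x' • h = c • r' + B r' w • w := by
    rw [hh, hr', B_add_left, B_smul_left, B_smul_left, hw]; module
  obtain ⟨X, hXdef⟩ : ∃ X, X = -B p' w := ⟨_, rfl⟩
  obtain ⟨Y, hYdef⟩ : ∃ Y, Y = B r' w := ⟨_, rfl⟩
  have hX' : B p' w = -X := by linarith
  rw [hX'] at eg hX
  rw [← hYdef] at eh hY
  have e1 : x ^ 2 * B g g = c * (c + X ^ 2) := by
    have : B (x • g) (x • g) = x ^ 2 * B g g := by rw [B_smul_left, B_smul_right]; ring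
    rw [← this, eg]
    simp only [B_add_left, B_add_right, B_smul_left, B_smul_right, hp1, hw, hX', B_comm w p']
    ring
  have e2 : x' ^ 2 * B h h = c * (c + Y ^ 2) := by
    have : B (x' • h) (x' • h) = x' ^ 2 * B h h := by rw [B_smul_left, B_smul_right]; ring
    rw [← this, eh]
    simp only [B_add_left, B_add_right, B_smul_left, B_smul_right, hr1, hw, ← hYdef, B_comm w r']
    ring
  have e3 : x * x' * B g h = c * (c * B p' r' - X * Y) := by
    have : B (x • g) (x' • h) = x * x' * B g h := by rw [B_smul_left, B_smul_right]; ring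
    rw [← this, eg, eh]
    simp only [B_add_left, B_add_right, B_smul_left, B_smul_right, hw, hX', ← hYdef, B_comm w r']
    ring
  have hXT : T ≤ X := by linarith
  by_contra! hcon
  have hX2 : T ^ 2 ≤ X ^ 2 := by gcongr
  have hY2 : T ^ 2 ≤ Y ^ 2 := by gcongr
  obtain ⟨D, hD⟩ : ∃ D, D = B g g * B h h := ⟨_, rfl⟩
  obtain ⟨N, hN⟩ : ∃ N, N = B g h ^ 2 := ⟨_, rfl⟩
  rw [← hD, ← hN] at hT
  have hN0 : 0 ≤ N := hN ▸ sq_nonneg _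
  have hXY : 0 < X * Y := mul_pos (by linarith) (by linarith)
  have h1 : (X * Y) ^ 2 ≤ (c * B p' r' - X * Y) ^ 2 := by
    have h0 : c * B p' r' ≤ 0 := mul_nonpos_of_nonneg_of_nonpos hc.le hcon
    nlinarith [mul_nonneg_of_nonpos_of_nonpos h0 h0, mul_nonneg (neg_nonneg.2 h0) hXY.le]
  have h2 : c ^ 2 * (X * Y) ^ 2 ≤ x ^ 2 * x' ^ 2 * N := by
    have : x ^ 2 * x' ^ 2 * N = c ^ 2 * (c * B p' r' - X * Y) ^ 2 := by
      rw [hN]; linear_combination (x * x' * B g h + c * (c * B p' r' - X * Y)) * e3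
    rw [this]
    gcongr
  have h3 : x ^ 2 * x' ^ 2 * D = c ^ 2 * ((c + X ^ 2) * (c + Y ^ 2)) := by
    rw [hD]; linear_combination x' ^ 2 * B h h * e1 + c * (c + X ^ 2) * e2
  have hT2 : 0 < T ^ 2 := by positivity
  have hDN : 0 < D - N := by
    by_contra! hle
    nlinarith [mul_nonneg hc.le hN0]
  have h4 : D * (X * Y) ^ 2 ≤ N * ((c + X ^ 2) * (c + Y ^ 2)) := by
    have : c ^ 2 * (D * (X * Y) ^ 2) ≤ c ^ 2 * (N * ((c + X ^ 2) * (c + Y ^ 2))) := by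
      have := mul_le_mul_of_nonneg_left h2 (by linarith : 0 ≤ D)
      calc _ = D * (c ^ 2 * (X * Y) ^ 2) := by ring
        _ ≤ _ := this
        _ = N * (x ^ 2 * x' ^ 2 * D) := by ring
        _ = _ := by rw [h3]; ring
    exact le_of_mul_le_mul_left this (by positivity)
  have h5 : T ^ 2 * (X ^ 2 + Y ^ 2 + c) ≤ 3 * (X * Y) ^ 2 := by
    nlinarith [mul_nonneg (sub_nonneg.2 hX2) (sq_nonneg Y), mul_nonneg (sub_nonneg.2 hY2)
      (sq_nonneg X), mul_nonneg (sub_nonneg.2 hX2) hT2.le, mul_nonneg (sub_nonneg.2 hTc) hT2.le]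
  have h6 : (D - N) * (X * Y) ^ 2 ≤ N * c * (X ^ 2 + Y ^ 2 + c) := by linarith
  have h7 : 0 < X ^ 2 + Y ^ 2 + c := by positivity
  have h8 := mul_le_mul_of_nonneg_left h5 hDN.le
  have h9 := mul_lt_mul_of_pos_right hT h7
  linarith

lemma IsBiclosed.no_relation_timelike {R : Set V} (hR : IsBiclosed R) {p q r s w : V}
    (hp : p ∈ halfSpace R) (hq : q ∈ halfSpace R) (hr : r ∈ halfSpace R) (hs : s ∈ halfSpace R)
    {a b c d : ℝ} (ha : 0 < a) (hb : 0 < b) (hc : 0 < c) (hd : 0 < d)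
    (hw : w = a • p + b • q) (hw' : -w = c • r + d • s) (hi : IntVec w) (hQ : B w w < 0)
    (ho : Oct w) (hdep : ∀ t₀ t₁ t₂ : ℝ, 0 < t₂ → t₀ • p + t₁ • q + t₂ • r ≠ 0) : False := by
  obtain ⟨e, he⟩ : ∃ e, e = -B w w := ⟨_, rfl⟩
  have hwe : B w w = -e := by linarith
  have he0 : 0 < e := by linarith
  obtain ⟨g, hg⟩ : ∃ g, g = e • p + B p w • w := ⟨_, rfl⟩
  obtain ⟨h, hh⟩ : ∃ h, h = e • r + B r w • w := ⟨_, rfl⟩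
  have hp1 := (mem_Φ_iff.1 (hR.halfSpace_subset hp)).2
  have hgg : 0 < B g g := by
    have : B g g = e * (e + B p w ^ 2) := by
      rw [hg]
      simp only [B_add_left, B_add_right, B_smul_left, B_smul_right, hp1, hwe, B_comm w p]
      ring
    rw [this]
    positivity
  have hNN : B g h ^ 2 < B g g * B h h := by
    refine B_sq_lt_of_orthogonal hQ ?_ ?_ hgg fun h0 => hdep
      (B g g * B r w * a - B g h * (e + B p w * a)) (B g g * B r w * b - B g h * (B p w * b))
      (B g g * e) (by positivity) ?_
    · rw [hg, B_add_right, B_smul_right, B_smul_right, hwe, B_comm w p]; ring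
    · rw [hh, B_add_right, B_smul_right, B_smul_right, hwe, B_comm w r]; ring
    · generalize B g g = G, B g h = H, B r w = y, B p w = x at *
      rw [hg, hh] at h0
      linear_combination (norm := module) h0 - (G * y - H * x) • hw
  obtain ⟨T, hT1, hT2, hT3, hT4⟩ : ∃ T : ℝ, 1 ≤ T ∧ e ≤ T ∧ ht w < T ∧
      3 * e * B g h ^ 2 < T * (B g g * B h h - B g h ^ 2) := by
    have hpos := sub_pos.2 hNN
    refine ⟨1 + e + |ht w| + 3 * e * B g h ^ 2 / (B g g * B h h - B g h ^ 2), ?_, ?_, ?_, ?_⟩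
    · have : 0 ≤ 3 * e * B g h ^ 2 / (B g g * B h h - B g h ^ 2) := by positivity
      linarith [abs_nonneg (ht w)]
    · have : 0 ≤ 3 * e * B g h ^ 2 / (B g g * B h h - B g h ^ 2) := by positivity
      linarith [abs_nonneg (ht w)]
    · have : 0 ≤ 3 * e * B g h ^ 2 / (B g g * B h h - B g h ^ 2) := by positivity
      linarith [le_abs_self (ht w)]
    · rw [← div_lt_iff₀ hpos]
      linarith [abs_nonneg (ht w)]
  have hTT : T ≤ T ^ 2 := by nlinarith
  have hT5 : 3 * e * B g h ^ 2 < T ^ 2 * (B g g * B h h - B g h ^ 2) := by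
    nlinarith [sub_pos.2 hNN]
  obtain ⟨p', hp', q', hq', a', b', ha', hb', hw₁, hxp, hxq, hpT, hqT⟩ :=
    hR.exists_far_pair hp hq ha hb hw hi hQ T
  obtain ⟨r', hr', s', hs', c', d', hc', hd', hw₂, hxr, hxs, hrT, hsT⟩ :=
    hR.exists_far_pair hr hs hc hd hw' hi.neg
      (by rwa [B_neg_left, B_neg_right, neg_neg]) T
  have hcross : ∀ x y, x ∈ halfSpace R → y ∈ halfSpace R → (∃ u v : ℝ, x = u • p + v • w) →
      (∃ u v : ℝ, y = u • r + v • -w) → B x w ≤ -T → B y (-w) ≤ -T → B x (-y) < 0 := by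
    rintro x y hx hy ⟨u, v, hu⟩ ⟨u', v', hu'⟩ hxT hyT
    rw [B_neg_right, neg_lt_zero]
    refine B_pos_of_far (y' := -v') hwe he0 hg hh hu (by rw [hu']; module)
      (mem_Φ_iff.1 (hR.halfSpace_subset hx)).2 (mem_Φ_iff.1 (hR.halfSpace_subset hy)).2
      (by linarith) (by linarith) hT5 hxT ?_
    rw [B_neg_right] at hyT
    linarith
  have hmemR : ∀ x, x ∈ halfSpace R → B x w ≤ -T → x ∈ R := by
    intro x hx hxT
    refine hx.resolve_right fun h => ?_
    have h1 : B (-x) w = -B x w := B_neg_left _ _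
    have := two_mul_B_le_ht ho hQ h.1 (by linarith)
    linarith
  have hmemN : ∀ x, x ∈ halfSpace R → B x (-w) ≤ -T → -x ∈ Φpos \ R := by
    intro x hx hxT
    refine hx.resolve_left fun h => ?_
    rw [B_neg_right] at hxT
    have := two_mul_B_le_ht ho hQ (hR.1 h) (by linarith)
    linarith
  classical
  have hcn : CrossNeg R (Φpos \ R) {p', q'} {-r', -s'} :=
    { subS := hR.1
      subT := Set.sdiff_subset
      closedS := hR.2.1
      closedT := hR.2.2
      cover := fun x hx => by by_cases h : x ∈ R <;> simp [h, hx]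
      disj := fun x hx h => h.2 hx
      memS := by
        simp only [Finset.mem_insert, Finset.mem_singleton]
        rintro x (rfl | rfl)
        exacts [hmemR _ hp' hpT, hmemR _ hq' hqT]
      memT := by
        simp only [Finset.mem_insert, Finset.mem_singleton]
        rintro x (rfl | rfl)
        exacts [hmemN _ hr' hrT, hmemN _ hs' hsT]
      nonemptyS := by simp
      nonemptyT := by simp
      neg := by
        simp only [Finset.mem_insert, Finset.mem_singleton]
        rintro x (rfl | rfl) y (rfl | rfl)
        exacts [hcross _ _ hp' hr' hxp hxr hpT hrT, hcross _ _ hp' hs' hxp hxs hpT hsT,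
          hcross _ _ hq' hr' hxq hxr hqT hrT, hcross _ _ hq' hs' hxq hxs hqT hsT] }
  obtain ⟨z, hz1, hz2⟩ := hcn.exists_separating
  have h1 := hz1 p' (by simp)
  have h2 := hz1 q' (by simp)
  have h3 := hz2 (-r') (by simp)
  have h4 := hz2 (-s') (by simp)
  rw [B_neg_right] at h3 h4
  have h5 : B z w = a' * B z p' + b' * B z q' := by rw [hw₁]; simp [B_add_right, B_smul_right]
  have h6 : B z (-w) = c' * B z r' + d' * B z s' := by rw [hw₂]; simp [B_add_right, B_smul_right]
  rw [B_neg_right] at h6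
  nlinarith

lemma IsBiclosed.no_relation_step {R : Set V} (hR : IsBiclosed R) {n : ℤ}
    (ih : ∀ p ∈ halfSpace R, ∀ q ∈ halfSpace R, ∀ r ∈ halfSpace R, ∀ s ∈ halfSpace R,
      ∀ a b c d : ℤ, 0 ≤ a → 0 ≤ b → 0 < c → 0 < d → a + b + c + d < n →
        (a : ℝ) • p + (b : ℝ) • q + (c : ℝ) • r + (d : ℝ) • s ≠ 0)
    {p q r s : V} (hp : p ∈ halfSpace R) (hq : q ∈ halfSpace R) (hr : r ∈ halfSpace R)
    (hs : s ∈ halfSpace R) {a b c d : ℤ} (ha : 0 < a) (hb : 0 < b) (hc : 0 < c) (hd : 0 < d)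
    (hn : a + b + c + d ≤ n)
    (h : (a : ℝ) • p + (b : ℝ) • q + (c : ℝ) • r + (d : ℝ) • s = 0) (hB : B p q < 0) : False := by
  have hpΦ := hR.halfSpace_subset hp
  have hqΦ := hR.halfSpace_subset hq
  have hrΦ := hR.halfSpace_subset hr
  have hsΦ := hR.halfSpace_subset hs
  have hp1 := (mem_Φ_iff.1 hpΦ).2
  have hq1 := (mem_Φ_iff.1 hqΦ).2
  have hr1 := (mem_Φ_iff.1 hrΦ).2
  have hs1 := (mem_Φ_iff.1 hsΦ).2
  have haR : (0 : ℝ) < a := by exact_mod_cast ha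
  have hbR : (0 : ℝ) < b := by exact_mod_cast hb
  have hcR : (0 : ℝ) < c := by exact_mod_cast hc
  have hdR : (0 : ℝ) < d := by exact_mod_cast hd
  have norm : ∀ {x y : V} (a b : ℝ), B x x = 1 → B y y = 1 →
      B (a • x + b • y) (a • x + b • y) = a ^ 2 + b ^ 2 + 2 * a * b * B x y := by
    intro x y a b hx hy
    simp only [B_add_left, B_add_right, B_smul_left, B_smul_right, hx, hy, B_comm y x]
    ring
  have hdep : ∀ {p q r s : V} {a b c d : ℝ}, p ∈ halfSpace R → q ∈ halfSpace R →
      r ∈ halfSpace R → s ∈ halfSpace R → 0 < a → 0 < b → 0 < c → 0 < d →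
      a • p + b • q + c • r + d • s = 0 → ∀ t : Fin 3 → ℝ, t ≠ 0 →
      t 0 • p + t 1 • q + t 2 • r ≠ 0 := by
    intro p q r s a b c d hp hq hr hs ha hb hc hd h t ht h'
    have key : ∀ t : Fin 3 → ℝ, t 0 • p + t 1 • q + t 2 • r = 0 → ∀ i, 0 < t i → False := by
      intro t ht i hi
      refine hR.no_relation_shift (v := ![p, q, r, s]) (a := ![a, b, c, d])
        (t := ![t 0, t 1, t 2, 0]) (i := i.castSucc) (j := 3) ?_ ?_ ?_ ?_ ?_ (by simp)
      · intro i; fin_cases i <;> assumption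
      · intro i; fin_cases i <;> assumption
      · simpa [Fin.sum_univ_four] using h
      · simpa [Fin.sum_univ_four] using ht
      · fin_cases i <;> simpa using hi
    obtain ⟨i, hi⟩ := Function.ne_iff.1 ht
    rcases lt_or_gt_of_ne hi with hi | hi
    · exact key (-t) (by simp only [Pi.neg_apply]; linear_combination (norm := module) -h') i
        (by simpa using hi)
    · exact key t h' i hi
  obtain ⟨w, hw⟩ : ∃ w, w = (a : ℝ) • p + (b : ℝ) • q := ⟨_, rfl⟩
  have hw' : -w = (c : ℝ) • r + (d : ℝ) • s := by
    rw [hw]; linear_combination (norm := module) -h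
  obtain ⟨k, hk⟩ := (mem_Φ_iff.1 hpΦ).1.B (mem_Φ_iff.1 hqΦ).1
  have hk1 : 1 ≤ -k := by
    have : k < 0 := by exact_mod_cast hk ▸ hB
    linarith
  have hQw : B w w = ((a ^ 2 + b ^ 2 - 2 * -k * a * b : ℤ) : ℝ) := by
    rw [hw, norm _ _ hp1 hq1, hk]; push_cast; ring
  have hQw' : B w w = c ^ 2 + d ^ 2 + 2 * c * d * B r s := by
    rw [← norm _ _ hr1 hs1, ← hw', B_neg_left, B_neg_right, neg_neg]
  rcases lt_trichotomy (B w w) 0 with hQ | hQ | hQ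
  · have hi : IntVec w := by
      obtain ⟨x, hx⟩ := (mem_Φ_iff.1 hpΦ).1
      obtain ⟨y, hy⟩ := (mem_Φ_iff.1 hqΦ).1
      exact ⟨fun i => a * x i + b * y i, fun i => by simp [hw, hx, hy]⟩
    rcases le_total 0 (ht w) with ho | ho
    · exact hR.no_relation_timelike hp hq hr hs haR hbR hcR hdR hw hw' hi hQ
        (oct_of_B_nonpos hQ.le ho) fun t₀ t₁ t₂ h2 h0 =>
          hdep hp hq hr hs haR hbR hcR hdR h ![t₀, t₁, t₂]
            (fun h3 => h2.ne' (congrFun h3 2)) h0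
    · have hQ' : B (-w) (-w) < 0 := by rwa [B_neg_left, B_neg_right, neg_neg]
      exact hR.no_relation_timelike hr hs hp hq hcR hdR haR hbR hw' (by rw [neg_neg, hw]) hi.neg hQ'
        (oct_of_B_nonpos hQ'.le (by rw [ht_neg]; linarith)) fun t₀ t₁ t₂ h2 h0 =>
          hdep hr hs hp hq hcR hdR haR hbR (by rw [← h]; module) ![t₀, t₁, t₂]
            (fun h3 => h2.ne' (congrFun h3 2)) h0
  · have hQZ : a ^ 2 + b ^ 2 - 2 * -k * a * b = 0 := by exact_mod_cast hQw ▸ hQ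
    obtain ⟨l, hl⟩ := (mem_Φ_iff.1 hrΦ).1.B (mem_Φ_iff.1 hsΦ).1
    have hQZ' : c ^ 2 + d ^ 2 + 2 * c * d * l = 0 := by
      rw [hl, hQ] at hQw'
      exact_mod_cast hQw'.symm
    obtain rfl := eq_of_sq_add_sq ha hb (k := -k) (by linarith)
    obtain rfl := eq_of_sq_add_sq hc hd (k := -l) (by linarith)
    have hk2 : k = -1 := by
      have : a ^ 2 * (1 + k) = 0 := by linarith
      have := (mul_eq_zero.1 this).resolve_left (by positivity)
      linarith
    have hl2 : l = -1 := by
      have : c ^ 2 * (1 + l) = 0 := by linarith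
      have := (mul_eq_zero.1 this).resolve_left (by positivity)
      linarith
    have hw0 : w ≠ 0 := fun h0 => hR.no_relation_three hp hq hp haR.le hbR.le le_rfl
      (by linarith) (by rw [← hw, h0]; module)
    obtain ⟨t, ht, h0⟩ := exists_relation_of_B_eq_zero (x := p) (y := q) (z := r) hw0
      (by rw [hw, B_add_left, B_smul_left, B_smul_left, hp1, B_comm q p, hk, hk2]; push_cast; ring)
      (by rw [hw, B_add_left, B_smul_left, B_smul_left, hq1, hk, hk2]; push_cast; ring)
      (by rw [← neg_neg w, hw', B_neg_left, B_add_left, B_smul_left, B_smul_left, hr1, B_comm s r,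
            hl, hl2]; push_cast; ring)
    exact hdep hp hq hr hs haR hbR hcR hdR h t ht h0
  · have hQZ : 0 < a ^ 2 + b ^ 2 - 2 * -k * a * b := by exact_mod_cast hQw ▸ hQ
    have hk' : B p q = -((-k : ℤ) : ℝ) := by rw [hk]; push_cast; ring
    obtain ⟨p', hp', q', hq', a', b', ha', hb', hlt, h'⟩ : ∃ p' ∈ halfSpace R, ∃ q' ∈ halfSpace R,
        ∃ a' b' : ℤ, 0 ≤ a' ∧ 0 ≤ b' ∧ a' + b' < a + b ∧ w = (a' : ℝ) • p' + (b' : ℝ) • q' := by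
      rcases le_total b a with hab | hab
      · rw [hw]
        exact hR.exists_shorter hp hq hk1 hk' ha hb hab hQZ
      · obtain ⟨p', hp', q', hq', a', b', ha', hb', hlt, h'⟩ :=
          hR.exists_shorter hq hp hk1 (B_comm p q ▸ hk') hb ha hab (by linarith)
        exact ⟨p', hp', q', hq', a', b', ha', hb', by linarith, by rw [← h', hw, add_comm]⟩
    refine ih p' hp' q' hq' r hr s hs a' b' c d ha' hb' hc hd (by linarith) ?_
    rw [← h', add_assoc, ← hw']
    module

lemma IsBiclosed.no_int_relation {R : Set V} (hR : IsBiclosed R) (n : ℕ) :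
    ∀ p ∈ halfSpace R, ∀ q ∈ halfSpace R, ∀ r ∈ halfSpace R, ∀ s ∈ halfSpace R,
      ∀ a b c d : ℤ, 0 ≤ a → 0 ≤ b → 0 < c → 0 < d → a + b + c + d < n →
        (a : ℝ) • p + (b : ℝ) • q + (c : ℝ) • r + (d : ℝ) • s ≠ 0 := by
  induction n with
  | zero => intros; push_cast at *; linarith
  | succ n ih =>
    intro p hp q hq r hr s hs a b c d ha hb hc hd hlt h
    have hcR : (0 : ℝ) < c := by exact_mod_cast hc
    have hdR : (0 : ℝ) < d := by exact_mod_cast hd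
    have haR : (0 : ℝ) ≤ a := by exact_mod_cast ha
    have hbR : (0 : ℝ) ≤ b := by exact_mod_cast hb
    rcases ha.eq_or_lt with rfl | ha
    · exact hR.no_relation_three hq hr hs hbR hcR.le hdR.le (by linarith)
        (by rw [← h]; push_cast; module)
    rcases hb.eq_or_lt with rfl | hb
    · exact hR.no_relation_three hp hr hs haR hcR.le hdR.le (by linarith)
        (by rw [← h]; push_cast; module)
    have hp1 := (mem_Φ_iff.1 (hR.halfSpace_subset hp)).2
    have h0 := congrArg (B p) h
    simp only [B_add_right, B_smul_right, B_zero_right, hp1] at h0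
    push_cast at hlt
    have hle := Int.lt_add_one_iff.1 hlt
    by_cases h1 : B p q < 0
    · exact hR.no_relation_step ih hp hq hr hs ha hb hc hd hle h h1
    by_cases h2 : B p r < 0
    · exact hR.no_relation_step ih hp hr hq hs ha hc hb hd (by linarith) (by rw [← h]; module) h2
    by_cases h3 : B p s < 0
    · exact hR.no_relation_step ih hp hs hq hr ha hd hb hc (by linarith) (by rw [← h]; module) h3
    push Not at h1 h2 h3
    have : (0 : ℝ) < a := by exact_mod_cast ha
    nlinarith [mul_nonneg hbR h1, mul_nonneg hcR.le h2, mul_nonneg hdR.le h3]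

/-- Four roots of the half-space attached to a biclosed set admit no nontrivial nonnegative
relation. -/
theorem IsBiclosed.no_relation_four {R : Set V} (hR : IsBiclosed R) {v : Fin 4 → V}
    (hv : ∀ i, v i ∈ halfSpace R) {a : Fin 4 → ℝ} (ha : ∀ i, 0 ≤ a i) (h0 : ∃ j, 0 < a j) :
    ∑ i, a i • v i ≠ 0 := by
  intro h
  obtain ⟨j, hj⟩ := h0
  have hapos : ∀ i, 0 < a i := fun i => (ha i).lt_of_ne' fun hi =>
    hR.no_relation_of_zero hv ha hi hj h
  have key : ∀ t : Fin 4 → ℤ, ∑ i, (t i : ℝ) • v i = 0 → ∀ i, 0 < t i → False := by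
    intro t ht i hi
    by_cases hpos : ∀ j, 0 < t j
    · rw [Fin.sum_univ_four] at ht
      exact hR.no_int_relation (t 0 + t 1 + t 2 + t 3 + 1).toNat _ (hv 0) _ (hv 1) _ (hv 2) _ (hv 3)
        _ _ _ _ (hpos 0).le (hpos 1).le (hpos 2) (hpos 3)
        (by rw [Int.toNat_of_nonneg (by linarith [hpos 0, hpos 1, hpos 2, hpos 3])]; linarith) ht
    · push Not at hpos
      obtain ⟨l, hl⟩ := hpos
      exact hR.no_relation_shift hv hapos h ht (i := i) (j := l) (by exact_mod_cast hi)
        (by exact_mod_cast hl)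
  obtain ⟨t, ht0, ht⟩ := exists_int_relation fun i => (mem_Φ_iff.1 (hR.halfSpace_subset (hv i))).1
  obtain ⟨i, hi⟩ := Function.ne_iff.1 ht0
  rcases lt_or_gt_of_ne hi with hi | hi
  · exact key (-t) (by simp [ht]) i (by simpa using hi)
  · exact key t ht i hi

/-! ### Convex closures of unions -/

lemma subset_nnspan {S : Set V} {x : V} (hx : x ∈ S) : x ∈ nnspan S := Submodule.subset_span hx

lemma add_mem_nnspan {S : Set V} {x y : V} (hx : x ∈ nnspan S) (hy : y ∈ nnspan S) :
    x + y ∈ nnspan S := Submodule.add_mem _ hx hy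

lemma smul_mem_nnspan {S : Set V} {x : V} {r : ℝ} (hr : 0 ≤ r) (hx : x ∈ nnspan S) :
    r • x ∈ nnspan S := Submodule.smul_mem _ (⟨r, hr⟩ : ℝ≥0) hx

lemma mem_nnspan_of_smul {S : Set V} {x : V} {r : ℝ} (hr : 0 < r) (hx : r • x ∈ nnspan S) :
    x ∈ nnspan S := by
  have := smul_mem_nnspan (inv_pos.2 hr).le hx
  rwa [smul_smul, inv_mul_cancel₀ hr.ne', one_smul] at this

lemma isClosedSet_inter_nnspan (S : Set V) : IsClosedSet (Φpos ∩ nnspan S) := by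
  rintro a ⟨-, ha⟩ b ⟨-, hb⟩ x ⟨hx, hxp⟩
  obtain ⟨s, t, hs, ht, rfl⟩ := mem_nnspan_pair.1 hx
  exact ⟨hxp, add_mem_nnspan (smul_mem_nnspan hs ha) (smul_mem_nnspan ht hb)⟩

lemma exists_two_of_three {S : Set V} (hS : S ⊆ Φpos) {x₀ : V} (h0 : x₀ ∈ S) {v : Fin 3 → V}
    (hv : ∀ i, v i ∈ S) {a : ℝ} (ha : 0 ≤ a) {b : Fin 3 → ℝ} (hb : ∀ i, 0 ≤ b i) :
    ∃ y ∈ S, ∃ z ∈ S, ∃ a' c d : ℝ, 0 ≤ a' ∧ 0 ≤ c ∧ 0 ≤ d ∧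
      a • x₀ + ∑ i, b i • v i = a' • x₀ + c • y + d • z := by
  have key : ∀ t : Fin 4 → ℝ, t ≠ 0 → t 0 • x₀ + ∑ i : Fin 3, t i.succ • v i = 0 → t 0 ≤ 0 →
      ∃ y ∈ S, ∃ z ∈ S, ∃ a' c d : ℝ, 0 ≤ a' ∧ 0 ≤ c ∧ 0 ≤ d ∧
        a • x₀ + ∑ i, b i • v i = a' • x₀ + c • y + d • z := by
    intro t ht h ht0
    obtain ⟨i, hi⟩ : ∃ i : Fin 3, 0 < t i.succ := by
      by_contra! hcon
      have hh := congrArg _root_.ht h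
      simp only [Fin.sum_univ_three, ht_add, ht_smul,
        show _root_.ht 0 = 0 by simp [_root_.ht]] at hh
      have p := one_le_ht (hS h0)
      have p0 := one_le_ht (hS (hv 0))
      have p1 := one_le_ht (hS (hv 1))
      have p2 := one_le_ht (hS (hv 2))
      have q0 := hcon 0
      have q1 := hcon 1
      have q2 := hcon 2
      have r0 : t 0 = 0 := le_antisymm ht0 (by nlinarith)
      have r1 : t (Fin.succ 0) = 0 := le_antisymm q0 (by nlinarith)
      have r2 : t (Fin.succ 1) = 0 := le_antisymm q1 (by nlinarith)
      have r3 : t (Fin.succ 2) = 0 := le_antisymm q2 (by nlinarith)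
      refine ht (funext (Fin.forall_fin_succ.2 ⟨r0, fun i => ?_⟩))
      fin_cases i
      exacts [r1, r2, r3]
    obtain ⟨u, hu, hnn, l, hl, hul⟩ := exists_shift (t := fun i => t i.succ) hb hi
    have hz : b l - u * t l.succ = 0 := by rw [hul]; field_simp; ring
    refine ⟨v (l.succAbove 0), hv _, v (l.succAbove 1), hv _, a - u * t 0,
      b (l.succAbove 0) - u * t (l.succAbove 0).succ,
      b (l.succAbove 1) - u * t (l.succAbove 1).succ, by nlinarith, hnn _, hnn _, ?_⟩
    rw [Fin.sum_univ_succAbove _ l, Fin.sum_univ_two] at h ⊢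
    linear_combination (norm := module) hz • v l + u • h
  obtain ⟨t, ht, h⟩ := exists_int_relation (v := Fin.cons x₀ v)
    (Fin.cases (mem_Φpos_iff.1 (hS h0)).1 fun i => (mem_Φpos_iff.1 (hS (hv i))).1)
  rw [Fin.sum_univ_succ] at h
  simp only [Fin.cons_zero, Fin.cons_succ] at h
  have hne : (fun i => (t i : ℝ)) ≠ 0 := fun h' => ht (funext fun i => by
    simpa using congrFun h' i)
  rcases le_total ((t 0 : ℤ) : ℝ) 0 with h' | h'
  · exact key _ hne h h'
  · refine key (fun i => -(t i : ℝ)) (fun h'' => hne ?_) ?_ (by simpa using h')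
    · ext i
      simpa using congrFun h'' i
    · rw [Fin.sum_univ_three] at h ⊢
      linear_combination (norm := module) -h

/-- A conic Carathéodory theorem in which one of the generators is prescribed. -/
lemma exists_eq_of_mem_nnspan {S : Set V} (hS : S ⊆ Φpos) {x₀ : V} (h0 : x₀ ∈ S) {x : V}
    (hx : x ∈ nnspan S) : ∃ y ∈ S, ∃ z ∈ S, ∃ a b c : ℝ, 0 ≤ a ∧ 0 ≤ b ∧ 0 ≤ c ∧
      x = a • x₀ + b • y + c • z := by
  induction hx using Submodule.span_induction with
  | mem x hx => exact ⟨x, hx, x, hx, 0, 1, 0, le_rfl, zero_le_one, le_rfl, by module⟩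
  | zero => exact ⟨x₀, h0, x₀, h0, 0, 0, 0, le_rfl, le_rfl, le_rfl, by module⟩
  | smul r x _ ih =>
    obtain ⟨y, hy, z, hz, a, b, c, ha, hb, hc, rfl⟩ := ih
    refine ⟨y, hy, z, hz, r * a, r * b, r * c, by positivity, by positivity, by positivity, ?_⟩
    rw [NNReal.smul_def]
    module
  | add x x' _ _ ih ih' =>
    obtain ⟨y, hy, z, hz, a, b, c, ha, hb, hc, rfl⟩ := ih
    obtain ⟨y', hy', z', hz', a', b', c', ha', hb', hc', rfl⟩ := ih'
    obtain ⟨y₁, hy₁, z₁, hz₁, a₁, b₁, c₁, ha₁, hb₁, hc₁, h₁⟩ := exists_two_of_three hS h0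
      (v := ![y, z, y']) (by simp [Fin.forall_fin_succ, hy, hz, hy']) (add_nonneg ha ha')
      (b := ![b, c, b']) (by simp [Fin.forall_fin_succ, hb, hc, hb'])
    obtain ⟨y₂, hy₂, z₂, hz₂, a₂, b₂, c₂, ha₂, hb₂, hc₂, h₂⟩ := exists_two_of_three hS h0
      (v := ![y₁, z₁, z']) (by simp [Fin.forall_fin_succ, hy₁, hz₁, hz']) ha₁
      (b := ![b₁, c₁, c']) (by simp [Fin.forall_fin_succ, hb₁, hc₁, hc'])
    refine ⟨y₂, hy₂, z₂, hz₂, a₂, b₂, c₂, ha₂, hb₂, hc₂, ?_⟩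
    simp [Fin.sum_univ_three] at h₁ h₂
    linear_combination (norm := module) h₁ + h₂

lemma exists_eq_of_orthogonal {δ ε x : V} (hδ : δ ∈ Φpos) (hε : ε ∈ Φpos) (hB : B δ ε = -1)
    (hx : B (δ + ε) x = 0) : ∃ a b : ℝ, x = a • δ + b • ε := by
  have hδ1 := B_self_of_mem hδ.1
  have hε1 := B_self_of_mem hε.1
  have hne : δ + ε ≠ 0 := fun h => by
    have := congrArg ht h
    rw [ht_add] at this
    have h1 := ht_pos hδ
    have h2 := ht_pos hε
    have h3 : ht 0 = 0 := by simp [ht]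
    linarith
  obtain ⟨t, ht, h⟩ := exists_relation_of_B_eq_zero hne (x := δ) (y := ε) (z := x)
    (by rw [B_add_left, hδ1, B_comm, hB]; norm_num) (by rw [B_add_left, hB, hε1]; norm_num) hx
  have h2 : t 2 ≠ 0 := by
    intro h2
    rw [h2, zero_smul, add_zero] at h
    have h01 := congrArg (B δ) h
    rw [B_add_right, B_smul_right, B_smul_right, B_zero_right, hδ1, hB] at h01
    have h1 : t 1 = t 0 := by linarith
    rw [h1, ← smul_add] at h
    have h0 := (smul_eq_zero.1 h).resolve_right hne
    exact ht (funext fun i => by fin_cases i <;> simp [h0, h1, h2])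
  refine ⟨-(t 0 / t 2), -(t 1 / t 2), ?_⟩
  have e0 : t 2 * (t 0 / t 2) = t 0 := by field_simp
  have e1 : t 2 * (t 1 / t 2) = t 1 := by field_simp
  refine smul_right_injective V h2 ?_
  linear_combination (norm := module) h + e0 • δ + e1 • ε

lemma neg_mem_halfSpace {R : Set V} {x : V} (hx : x ∈ Φpos) (hxR : x ∉ R) :
    -x ∈ halfSpace R := Or.inr (by rw [neg_neg]; exact ⟨hx, hxR⟩)

lemma IsBiclosed.no_relation_four' {R : Set V} (hR : IsBiclosed R) {x y z w : V} {a b c d : ℝ}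
    (hx : x ∈ halfSpace R) (hy : y ∈ halfSpace R) (hz : z ∈ halfSpace R) (hw : w ∈ halfSpace R)
    (ha : 0 ≤ a) (hb : 0 ≤ b) (hc : 0 ≤ c) (hd : 0 < d) :
    a • x + b • y + c • z + d • w ≠ 0 := by
  have := hR.no_relation_four (v := ![x, y, z, w]) (a := ![a, b, c, d])
    (by simp [Fin.forall_fin_succ, *]) (by simp [Fin.forall_fin_succ, hd.le, *]) ⟨3, hd⟩
  simpa [Fin.sum_univ_four] using this

/-- If a nonnegative combination `γ` of elements of two biclosed sets sharing `x₀` also lies in the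
interior of the cone spanned by a generator and a shorter root, then `γ` is in the closure. -/
lemma mem_of_split {R₁ R₂ C S : Set V} (h₁ : IsBiclosed R₁) (h₂ : IsBiclosed R₂)
    (hC : IsClosedSet C) (h₁S : R₁ ⊆ S) (h₂S : R₂ ⊆ S) (hSC : S ⊆ C) {x₀ x₁ x₂ γ ε : V}
    (hx₀ : x₀ ∈ R₂) (hx₁ : x₁ ∈ R₁) (hx₂ : x₂ ∈ R₂) (hγ : γ ∈ Φpos) (hε : ε ∈ Φpos)
    (ih : ∀ ε ∈ Φpos, ht ε < ht γ → ε ∈ nnspan S → ε ∈ C) {a b c k l : ℝ} (ha : 0 ≤ a)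
    (hb : 0 ≤ b) (hc : 0 ≤ c) (e : γ = a • x₀ + b • x₁ + c • x₂) (hk : 0 < k) (hl : 0 < l)
    (hlt : ht ε < ht γ) (e' : γ = k • x₁ + l • ε) : γ ∈ C := by
  by_contra hγC
  have hγC' : -γ ∈ halfSpace R₂ := neg_mem_halfSpace hγ fun h => hγC (hSC (h₂S h))
  have hεC : ε ∉ C := fun h => hγC (hC.mem (hSC (h₁S hx₁)) h hγ hk.le hl.le e')
  rcases le_or_gt k b with hkb | hkb
  · refine hεC (ih ε hε hlt (mem_nnspan_of_smul hl ?_))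
    have : l • ε = a • x₀ + (b - k) • x₁ + c • x₂ := by
      linear_combination (norm := module) e - e'
    rw [this]
    exact add_mem_nnspan (add_mem_nnspan (smul_mem_nnspan ha (subset_nnspan (h₂S hx₀)))
      (smul_mem_nnspan (sub_nonneg.2 hkb) (subset_nnspan (h₁S hx₁))))
      (smul_mem_nnspan hc (subset_nnspan (h₂S hx₂)))
  · have hεN : -ε ∈ halfSpace R₂ := neg_mem_halfSpace hε fun h => hεC (hSC (h₂S h))
    have hx₁R : x₁ ∉ R₂ := fun h =>
      h₂.no_relation_four' (Or.inl hx₀) (Or.inl h) (Or.inl hx₂) hγC' ha hb hc zero_lt_one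
        (by linear_combination (norm := module) -e)
    exact h₂.no_relation_four' (a := a) (b := c) (c := k - b) (Or.inl hx₀) (Or.inl hx₂)
      (neg_mem_halfSpace (h₁.1 hx₁) hx₁R) hεN ha hc (by linarith) hl
      (by linear_combination (norm := module) e' - e)

/-- In the plane of a tangent decomposition `γ = s δ + t ε`, a combination of `x₀` and `x₁`
strictly on the side of `δ` forces `δ` into the closure. -/
lemma mem_of_tangent_side {R C S : Set V} (hR : IsBiclosed R) (hRS : R ⊆ S) (hSC : S ⊆ C)
    {x₀ x₁ γ δ ε : V} (hx₀ : x₀ ∈ R) (hx₁ : x₁ ∈ R) (hγ : γ ∈ Φpos) (hδ : δ ∈ Φpos)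
    (ih : ∀ ε ∈ Φpos, ht ε < ht γ → ε ∈ nnspan S → ε ∈ C) (hγC : γ ∉ C) (hγS : γ ∈ nnspan S)
    {s t u v x y : ℝ} (ht' : 0 ≤ t) (e : γ = s • δ + t • ε) (hlt : ht δ < ht γ) (hu : 0 ≤ u)
    (hv : 0 ≤ v) (e' : u • x₀ + v • x₁ = x • δ + y • ε) (hD : 0 < x * t - y * s) : δ ∈ C := by
  have key : (t * u) • x₀ + (t * v) • x₁ = (x * t - y * s) • δ + y • γ := by
    linear_combination (norm := module) t • e' - y • e
  by_contra hδC
  rcases le_or_gt 0 y with hy | hy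
  · exact hR.no_relation_four' (a := t * u) (b := t * v) (Or.inl hx₀) (Or.inl hx₁)
      (neg_mem_halfSpace hγ fun h => hγC (hSC (hRS h)))
      (neg_mem_halfSpace hδ fun h => hδC (hSC (hRS h))) (by positivity) (by positivity)
      hy hD (by linear_combination (norm := module) key)
  · refine hδC (ih δ hδ hlt (mem_nnspan_of_smul hD ?_))
    have : (x * t - y * s) • δ = (t * u) • x₀ + (t * v) • x₁ + (-y) • γ := by
      linear_combination (norm := module) -key
    rw [this]
    exact add_mem_nnspan (add_mem_nnspan
      (smul_mem_nnspan (by positivity) (subset_nnspan (hRS hx₀)))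
      (smul_mem_nnspan (by positivity) (subset_nnspan (hRS hx₁))))
      (smul_mem_nnspan (by linarith) hγS)

lemma eq_zero_of_tangent {δ ε : V} (hδ : δ ∈ Φpos) (hε : ε ∈ Φpos) (hB : B δ ε = -1) {p q : ℝ}
    (h : p • δ + q • ε = 0) : p = 0 ∧ q = 0 := by
  have h1 := congrArg (B δ) h
  have h2 := congrArg ht h
  rw [B_add_right, B_smul_right, B_smul_right, B_zero_right, B_self_of_mem hδ.1, hB] at h1
  rw [ht_add, ht_smul, ht_smul, show ht 0 = 0 by simp [ht]] at h2
  obtain rfl : p = q := by linarith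
  have hp : p = 0 := by
    have h3 : p * (ht δ + ht ε) = 0 := by linarith
    exact (mul_eq_zero.1 h3).resolve_right (add_pos (ht_pos hδ) (ht_pos hε)).ne'
  exact ⟨hp, hp⟩

/-- Simple roots span extremal rays. -/
lemma eq_α_of_eq {i : Fin 3} {x y z : V} {a b c : ℝ} (hx : x ∈ Φpos) (hy : y ∈ Φpos)
    (hz : z ∈ Φpos) (ha : 0 ≤ a) (hb : 0 < b) (hc : 0 ≤ c) (h : α i = a • x + b • y + c • z) :
    y = α i := by
  obtain ⟨-, hy1, hyo⟩ := mem_Φpos_iff.1 hy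
  have key : ∀ j, α i j = 0 → y j = 0 := fun j hj => by
    have := congrFun h j
    simp only [hj, Pi.add_apply, Pi.smul_apply, smul_eq_mul] at this
    have h1 := mul_nonneg ha ((mem_Φpos_iff.1 hx).2.2 j)
    have h2 := mul_nonneg hc ((mem_Φpos_iff.1 hz).2.2 j)
    have h3 := mul_nonneg hb.le (hyo j)
    exact (mul_eq_zero.1 (by linarith : b * y j = 0)).resolve_left hb.ne'
  obtain ⟨-, h1, h2⟩ := (eq_α_iff (α i) i).1 rfl
  rw [B_self_eq y i, key _ h1, key _ h2] at hy1
  refine (eq_α_iff y i).2 ⟨?_, key _ h1, key _ h2⟩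
  nlinarith [hyo i]

/-- The inductive step: a positive root which is a nonnegative combination of elements of two
biclosed sets, one of them common to both, lies in the closure if all shorter roots of the convex
closure do. -/
lemma mem_of_eq {R₁ R₂ C S : Set V} (h₁ : IsBiclosed R₁) (h₂ : IsBiclosed R₂)
    (hC : IsClosedSet C) (h₁S : R₁ ⊆ S) (h₂S : R₂ ⊆ S) (hSC : S ⊆ C) {x₀ x₁ x₂ γ : V}
    (hx₀₁ : x₀ ∈ R₁) (hx₀₂ : x₀ ∈ R₂) (hx₁ : x₁ ∈ R₁) (hx₂ : x₂ ∈ R₂) (hγ : γ ∈ Φpos)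
    (ih : ∀ ε ∈ Φpos, ht ε < ht γ → ε ∈ nnspan S → ε ∈ C) {a b c : ℝ} (ha : 0 ≤ a)
    (hb : 0 ≤ b) (hc : 0 ≤ c) (e : γ = a • x₀ + b • x₁ + c • x₂) : γ ∈ C := by
  by_contra hγC
  have hx₀C := hSC (h₁S hx₀₁)
  have hx₁C := hSC (h₁S hx₁)
  have hx₂C := hSC (h₂S hx₂)
  have pair : ∀ {x y : V} {s t : ℝ}, x ∈ C → y ∈ C → 0 ≤ s → 0 ≤ t → γ ≠ s • x + t • y :=
    fun hx hy hs ht h => hγC (hC.mem hx hy hγ hs ht h)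
  have hb' : 0 < b := hb.lt_of_ne' fun h =>
    pair hx₀C hx₂C ha hc (by rw [e, h]; module)
  have hc' : 0 < c := hc.lt_of_ne' fun h =>
    pair hx₀C hx₁C ha hb (by rw [e, h]; module)
  have ha' : 0 < a := ha.lt_of_ne' fun h =>
    pair hx₁C hx₂C hb hc (by rw [e, h]; module)
  have hns : ∀ i, γ ≠ α i := fun i hi => hγC <| by
    rw [hi, ← eq_α_of_eq (h₁.1 hx₀₁) (h₁.1 hx₁) (h₂.1 hx₂) ha hb' hc (hi.symm.trans e)]
    exact hx₁C
  obtain ⟨δ, hδ, ε, hε, s, t, hs, ht1, e', hB⟩ := exists_tangent hγ hns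
  obtain ⟨hltδ, hltε⟩ := ht_lt_of_tangent hδ hε hs ht1 e'
  have hγ0 : B (δ + ε) γ = 0 := by
    rw [e', B_add_left, B_add_right, B_add_right]
    simp only [B_smul_right, B_self_of_mem hδ.1, B_self_of_mem hε.1, B_comm ε δ, hB]
    ring
  have nonpos : ∀ x ∈ Φpos, x ∈ C → (∀ {ε : V} {k l : ℝ}, ε ∈ Φpos → 0 < k → 0 < l →
      ht ε < ht γ → γ = k • x + l • ε → γ ∈ C) → B (δ + ε) x ≤ 0 := by
    intro x hx hxC h
    by_contra! hpos
    obtain ⟨hxγ, hlt⟩ := above_tangent hγ hδ hε hB e' hx hpos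
    obtain ⟨η, hη, k, l, hk, hl, hηlt, e''⟩ :=
      exists_split hx hγ (fun h => hγC (h ▸ hxC)) hxγ hlt.le
    exact hγC (h hη hk hl hηlt e'')
  have f1 : B (δ + ε) x₁ ≤ 0 := nonpos x₁ (h₁.1 hx₁) hx₁C fun hε hk hl hlt e'' =>
    mem_of_split h₁ h₂ hC h₁S h₂S hSC hx₀₂ hx₁ hx₂ hγ hε ih ha hb hc e hk hl hlt e''
  have f2 : B (δ + ε) x₂ ≤ 0 := nonpos x₂ (h₂.1 hx₂) hx₂C fun hε hk hl hlt e'' =>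
    mem_of_split h₂ h₁ hC h₂S h₁S hSC hx₀₁ hx₂ hx₁ hγ hε ih ha hc hb
      (by rw [e]; module) hk hl hlt e''
  have f0 : a * B (δ + ε) x₀ + b * B (δ + ε) x₁ + c * B (δ + ε) x₂ = 0 := by
    rw [← hγ0, e]
    simp only [B_add_right _ _ (δ + ε), B_smul_right _ _ (δ + ε)]
  rcases (show 0 ≤ B (δ + ε) x₀ by nlinarith).eq_or_lt with h0 | h0
  · have h1 : B (δ + ε) x₁ = 0 := by nlinarith
    have h2 : B (δ + ε) x₂ = 0 := by nlinarith
    have hne : δ + ε ≠ 0 := fun h => one_ne_zero (eq_zero_of_tangent hδ hε hB (p := 1) (q := 1)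
      (by rw [one_smul, one_smul, h])).1
    obtain ⟨r, hr, i, hi, h⟩ : ∃ r : Fin 3 → ℝ, r ≠ 0 ∧ ∃ i, 0 < r i ∧
        r 0 • x₀ + r 1 • x₁ + r 2 • x₂ = 0 := by
      obtain ⟨r, hr, h⟩ := exists_relation_of_B_eq_zero hne h0.symm h1 h2
      obtain ⟨i, hi⟩ := Function.ne_iff.1 hr
      rcases lt_or_gt_of_ne hi with hi | hi
      · refine ⟨-r, neg_ne_zero.2 hr, i, by simpa using hi, ?_⟩
        simp only [Pi.neg_apply]
        linear_combination (norm := module) -h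
      · exact ⟨r, hr, i, hi, h⟩
    obtain ⟨u, hu, hnn, l, hl, hul⟩ := exists_shift (a := ![a, b, c])
      (by simp [Fin.forall_fin_succ, ha, hb, hc]) hi
    have hz : ![a, b, c] l - u * r l = 0 := by rw [hul]; field_simp; ring
    have n0 := hnn 0
    have n1 := hnn 1
    have n2 := hnn 2
    simp only [Matrix.cons_val] at n0 n1 n2
    fin_cases l <;> simp only [Fin.zero_eta, Fin.mk_one, Fin.reduceFinMk, Matrix.cons_val] at hz
    · exact pair hx₁C hx₂C n1 n2 (by linear_combination (norm := module) e + hz • x₀ + u • h)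
    · exact pair hx₀C hx₂C n0 n2 (by linear_combination (norm := module) e + hz • x₁ + u • h)
    · exact pair hx₀C hx₁C n0 n1 (by linear_combination (norm := module) e + hz • x₂ + u • h)
  · have orth : ∀ x, ∃ p q : ℝ,
        (-B (δ + ε) x) • x₀ + B (δ + ε) x₀ • x = p • δ + q • ε := fun x =>
      exists_eq_of_orthogonal hδ hε hB (by rw [B_add_right, B_smul_right, B_smul_right]; ring)
    obtain ⟨p₁, q₁, e₁⟩ := orth x₁
    obtain ⟨p₂, q₂, e₂⟩ := orth x₂
    have hsum : (b * p₁ + c * p₂ - B (δ + ε) x₀ * s) • δ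
        + (b * q₁ + c * q₂ - B (δ + ε) x₀ * t) • ε = 0 := by
      linear_combination (norm := module)
        B (δ + ε) x₀ • e' - B (δ + ε) x₀ • e - b • e₁ - c • e₂ - f0 • x₀
    obtain ⟨hp, hq⟩ := eq_zero_of_tangent hδ hε hB hsum
    have hD : b * (p₁ * t - q₁ * s) + c * (p₂ * t - q₂ * s) = 0 := by
      linear_combination t * hp - s * hq
    have hγS : γ ∈ nnspan S := by
      rw [e]
      exact add_mem_nnspan (add_mem_nnspan (smul_mem_nnspan ha (subset_nnspan (h₁S hx₀₁)))
        (smul_mem_nnspan hb (subset_nnspan (h₁S hx₁))))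
        (smul_mem_nnspan hc (subset_nnspan (h₂S hx₂)))
    have hs0 : 0 ≤ s := by linarith
    have ht0 : 0 ≤ t := by linarith
    have e'' : γ = t • ε + s • δ := by rw [e', add_comm]
    have n1 := neg_nonneg.2 f1
    have n2 := neg_nonneg.2 f2
    rcases lt_trichotomy (p₁ * t - q₁ * s) 0 with h | h | h
    · refine pair ?_ ?_ hs0 ht0 e'
      · exact mem_of_tangent_side h₂ h₂S hSC hx₀₂ hx₂ hγ hδ ih hγC hγS ht0 e' hltδ n2 h0.le e₂
          (by nlinarith)
      · exact mem_of_tangent_side h₁ h₁S hSC hx₀₁ hx₁ hγ hε ih hγC hγS hs0 e'' hltε n1 h0.le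
          (by rw [e₁, add_comm]) (by linarith)
    · have e₃ : (s * -B (δ + ε) x₁) • x₀ + (s * B (δ + ε) x₀) • x₁ = p₁ • γ := by
        linear_combination (norm := module) s • e₁ - p₁ • e' - h • ε
      have hpos : 0 < s * B (δ + ε) x₀ := by positivity
      have hnn : 0 ≤ s * -B (δ + ε) x₁ := mul_nonneg hs0 n1
      have hp₁ : 0 ≤ p₁ := by
        have h4 := congrArg ht e₃
        simp only [ht_add _ _, ht_smul] at h4
        have h5 := ht_pos hγ
        have h6 := ht_pos (h₁.1 hx₀₁)
        have h7 := ht_pos (h₁.1 hx₁)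
        exact nonneg_of_mul_nonneg_left (h4 ▸ by positivity) h5
      exact hγC (hSC (h₁S (h₁.mem_of_two hx₀₁ hx₁ hγ hnn hpos.le hp₁ (by linarith) e₃)))
    · refine pair ?_ ?_ hs0 ht0 e'
      · exact mem_of_tangent_side h₁ h₁S hSC hx₀₁ hx₁ hγ hδ ih hγC hγS ht0 e' hltδ n1 h0.le e₁ h
      · exact mem_of_tangent_side h₂ h₂S hSC hx₀₂ hx₂ hγ hε ih hγC hγS hs0 e'' hltε n2 h0.le
          (by rw [e₂, add_comm]) (by nlinarith)

lemma mem_of_mem_nnspan_iUnion {I : Type*} {R : I → Set V} (hR : ∀ i, IsBiclosed (R i)) {x₀ : V}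
    (h0 : ∀ i, x₀ ∈ R i) {C : Set V} (hC : IsClosedSet C) (hRC : ⋃ i, R i ⊆ C) {γ : V}
    (hγ : γ ∈ Φpos) (hγS : γ ∈ nnspan (⋃ i, R i)) : γ ∈ C := by
  obtain ⟨hi, -, ho⟩ := mem_Φpos_iff.1 hγ
  revert hγ hγS
  refine ht_induction (p := fun γ => γ ∈ Φpos → γ ∈ nnspan (⋃ i, R i) → γ ∈ C)
    (fun γ _ _ ih hγ hγS => ?_) hi ho
  have hS : ⋃ i, R i ⊆ Φpos := Set.iUnion_subset fun i => (hR i).1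
  rcases isEmpty_or_nonempty I with hI | ⟨⟨j⟩⟩
  · rw [Set.iUnion_of_empty, nnspan, Submodule.span_empty] at hγS
    exact absurd hγS (ne_zero_of_mem_Φ hγ.1)
  · obtain ⟨y, hy, z, hz, a, b, c, ha, hb, hc, e⟩ :=
      exists_eq_of_mem_nnspan hS (Set.mem_iUnion.2 ⟨j, h0 j⟩) hγS
    obtain ⟨i₁, hy⟩ := Set.mem_iUnion.1 hy
    obtain ⟨i₂, hz⟩ := Set.mem_iUnion.1 hz
    exact mem_of_eq (hR i₁) (hR i₂) hC (Set.subset_iUnion R i₁) (Set.subset_iUnion R i₂) hRC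
      (h0 i₁) (h0 i₂) hy hz hγ (fun ε hε hlt => ih ε (mem_Φpos_iff.1 hε).1 (mem_Φpos_iff.1 hε).2.2
        hlt hε) ha hb hc e

/-- If a collection of biclosed subsets of `Φ⁺` has a common simple root, then the
smallest closed subset of `Φ⁺` containing their union equals `Φ⁺ ∩ Span_{≥0}(⋃ᵢ Rᵢ)`. -/
theorem two_closure_eq_convex_closure {I : Type*} (R : I → Set V)
    (hR : ∀ i, IsBiclosed (R i)) (hsimple : ∃ k : Fin 3, α k ∈ ⋂ i, R i) :
    ⋂₀ {C : Set V | C ⊆ Φpos ∧ IsClosedSet C ∧ (⋃ i, R i) ⊆ C}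
      = Φpos ∩ nnspan (⋃ i, R i) := by
  obtain ⟨k, hk⟩ := hsimple
  refine Set.Subset.antisymm (Set.sInter_subset_of_mem ⟨Set.inter_subset_left,
    isClosedSet_inter_nnspan _, fun x hx => ⟨?_, subset_nnspan hx⟩⟩) ?_
  · obtain ⟨i, hi⟩ := Set.mem_iUnion.1 hx
    exact (hR i).1 hi
  · rintro γ ⟨hγ, hγS⟩ C ⟨-, hC, hRC⟩
    exact mem_of_mem_nnspan_iUnion hR (Set.mem_iInter.1 hk) hC hRC hγ hγS
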